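/- arXiv:2211.03354 — 2 statements merged into one kernel-verified Lean document; each statement's English description precedes it below -/
import Mathlib

section
/- The polynomials P_{λ,μ}(q) satisfy the following recursion. (1) P_{λ,λ}(q) = 1, and P_{λ,μ}(q) = 0 whenever λ ≠ μ and |λ| ≥ |μ|. (2) If |λ| < |μ|, then there exists a largest index i with λ(i) = ↓ and λ(i+1) = ↑; set C = (i, i+1), let λ″ = s_C(λ), and let λ′ and μ′ be the weights of type (m−1, n−1) obtained from λ and μ by deleting positions i and i+1. Then P_{λ,μ}(q) = P_{λ′,μ′}(q) + q·P_{λ″,μ}(q) if μ(i) = ↓ and μ(i+1) = ↑, and P_{λ,μ}(q) = q·P_{λ″,μ}(q) otherwise, where P_{λ′,μ′}(q) is computed in Q̄_{m−1}^{n−1}. -/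
open scoped Classical

namespace Kh

abbrev Wt (N : ℕ) := Fin N → Bool

variable {N : ℕ}

/-- A weight of type `(m,n)`: `m` downs (`true`) and `n` ups (`false`). -/
def IsWeight (m n : ℕ) (l : Wt N) : Prop :=
  {i : Fin N | l i = true}.ncard = m ∧ {i : Fin N | l i = false}.ncard = n

/-- The height of a weight: sum over downs of the number of ups to the left. -/
noncomputable def height (l : Wt N) : ℕ :=
  ∑ i : Fin N, if l i = true then {j : Fin N | j < i ∧ l j = false}.ncard else 0

/-- Number of positions `t` with `i < t ≤ j` and value `b`. -/
noncomputable def cnt (l : Wt N) (b : Bool) (i j : Fin N) : ℕ :=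
  {t : Fin N | i < t ∧ t ≤ j ∧ l t = b}.ncard

/-- `(i,j)` is a matched pair ("circle") of the standard non-crossing bracket matching
of `l` (reading `true` = ↓ as an opening bracket and `false` = ↑ as a closing bracket):
`l i = ↓`, `l j = ↑`, the segment strictly between `i` and `j` is balanced and every
prefix of it has at least as many ↓'s as ↑'s. -/
def IsCircle (l : Wt N) (i j : Fin N) : Prop :=
  i < j ∧ l i = true ∧ l j = false ∧
    cnt l true i j + 1 = cnt l false i j ∧
    ∀ k : Fin N, i < k → k < j → cnt l false i k ≤ cnt l true i k

/-- `s_C(λ)`: exchange the values of `l` at the two positions of the circle `C = (i,j)`. -/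
def swapC (l : Wt N) (i j : Fin N) : Wt N :=
  fun t => if t = i then l j else if t = j then l i else l t

/-- The circle `(i,j)` encloses the circle `(i',j')`. -/
def Encloses (i j i' j' : Fin N) : Prop := i < i' ∧ j' < j

/-- The circle `(i,j)` lies to the left of the circle `(i',j')`. -/
def LeftOf (i j i' j' : Fin N) : Prop := j < i'

/-- The position `p` is unmatched in `l`. -/
def Unmatched (l : Wt N) (p : Fin N) : Prop :=
  ∀ q : Fin N, ¬ IsCircle l p q ∧ ¬ IsCircle l q p

/-- `def(λ)`: the number of circles of `l`. -/
noncomputable def defect (l : Wt N) : ℕ :=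
  {p : Fin N × Fin N | IsCircle l p.1 p.2}.ncard

/-- One step up in the graph `Γ_m^n`: `m' = s_C(l)` for some circle `C` of `l`. -/
def GammaStep (l m' : Wt N) : Prop :=
  ∃ i j : Fin N, IsCircle l i j ∧ m' = swapC l i j

/-- Adjacency in the graph `Γ_m^n`. -/
def GammaAdj (l m' : Wt N) : Prop := GammaStep l m' ∨ GammaStep m' l

/-- The order embedding `Fin N → Fin (N+2)` skipping the two positions `i`, `i+1`;
composing a weight with it deletes these two positions. -/
def skip2 (i : ℕ) {N : ℕ} (t : Fin N) : Fin (N + 2) :=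
  if (t : ℕ) < i then Fin.castLE (Nat.le_add_right N 2) t
  else ⟨(t : ℕ) + 2, Nat.add_lt_add_right t.isLt 2⟩

end Kh

namespace Kh

variable {N : ℕ}

/-- Type (I) elements of `S_m^n`: an ascending arrow into a vertex followed by a
descending arrow out of it (as vertex lists of the corresponding paths in `Q̄_m^n`). -/
def SType1 (p : List (Wt N)) : Prop :=
  ∃ x y z : Wt N, p = [x, y, z] ∧ GammaStep x y ∧ GammaStep z y

/-- Ascending type (II) elements of `S_m^n`: `ȳ_λ^ν ȳ_ν^μ` with `ν = s_C(λ)`,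
`μ = s_{C'}(ν)`, where `C'` is a circle of `λ` enclosed in `C` or lying to the right
of `C`. -/
def SType2Asc (p : List (Wt N)) : Prop :=
  ∃ (la : Wt N) (i j i' j' : Fin N),
    IsCircle la i j ∧ IsCircle la i' j' ∧
    (Encloses i j i' j' ∨ LeftOf i j i' j') ∧
    IsCircle (swapC la i j) i' j' ∧
    p = [la, swapC la i j, swapC (swapC la i j) i' j']

/-- Ascending type (III) elements of `S_m^n` (length `k ≥ 3`), written with 0-based
vertices `v 0, …, v k` (so `λ_t = v (t-1)`) and 1-based circles `C_i = (a i, b i)`. -/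
def SType3Asc (p : List (Wt N)) : Prop :=
  ∃ (k : ℕ) (v : ℕ → Wt N) (a b : ℕ → Fin N),
    3 ≤ k ∧
    p = List.ofFn (fun t : Fin (k + 1) => v t.val) ∧
    (∀ i, 1 ≤ i → i ≤ k →
      IsCircle (v (i - 1)) (a i) (b i) ∧ v i = swapC (v (i - 1)) (a i) (b i)) ∧
    (∀ i, 2 ≤ i → i ≤ k - 1 → ¬ IsCircle (v (i - 2)) (a i) (b i)) ∧
    (∀ j, 1 ≤ j → j ≤ k → IsCircle (v (j - 1)) (a k) (b k)) ∧
    Encloses (a 1) (b 1) (a k) (b k) ∧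
    (∀ i, 2 ≤ i → i ≤ k - 1 → LeftOf (a k) (b k) (a i) (b i))

/-- Membership in the reduction set `S_m^n` (vertex-list model: the descending
elements are the reverses of the ascending ones). -/
def InS (p : List (Wt N)) : Prop :=
  SType1 p ∨ SType2Asc p ∨ SType2Asc p.reverse ∨ SType3Asc p ∨ SType3Asc p.reverse

/-- A path in `Q̄_m^n` (given by its vertex list) is irreducible if no contiguous
subpath of it belongs to `S_m^n`. -/
def Irreducible (p : List (Wt N)) : Prop :=
  ∀ s, s <:+: p → ¬ InS s

/-- The number of ascending irreducible paths of length `k` from `la` to `mu`. -/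
noncomputable def ascCount (k : ℕ) (la mu : Wt N) : ℕ :=
  {p : List (Wt N) | p.length = k + 1 ∧ p.head? = some la ∧ p.getLast? = some mu ∧
    p.Chain' GammaStep ∧ Irreducible p}.ncard

/-- The total number of irreducible paths from `la` to `mu`. -/
noncomputable def irrCount (la mu : Wt N) : ℕ :=
  {p : List (Wt N) | p ≠ [] ∧ p.head? = some la ∧ p.getLast? = some mu ∧
    p.Chain' GammaAdj ∧ Irreducible p}.ncard

end Kh

namespace Kh


/-! ### Height functions -/

section heights

variable {N : ℕ}

/-- Step of the height function. -/
def wstep (l : Wt N) (t : ℕ) : ℤ :=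
  if h : t < N then (if l ⟨t, h⟩ = true then 1 else -1) else 0

/-- Height function. -/
def hf (l : Wt N) : ℕ → ℤ
  | 0 => 0
  | k + 1 => hf l k + wstep l k

theorem wstep_true {l : Wt N} {t : Fin N} (h : l t = true) : wstep l t = 1 := by
  simp [wstep, h]

theorem wstep_false {l : Wt N} {t : Fin N} (h : l t = false) : wstep l t = -1 := by
  simp [wstep, h]

theorem wstep_bound (l : Wt N) (t : ℕ) : -1 ≤ wstep l t ∧ wstep l t ≤ 1 := by
  unfold wstep; split_ifs <;> simp

theorem hf_succ (l : Wt N) (k : ℕ) : hf l (k + 1) = hf l k + wstep l k := rfl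

theorem hf_true {l : Wt N} {t : Fin N} (h : l t = true) :
    hf l ((t : ℕ) + 1) = hf l t + 1 := by rw [hf_succ, wstep_true h]

theorem hf_false {l : Wt N} {t : Fin N} (h : l t = false) :
    hf l ((t : ℕ) + 1) = hf l t - 1 := by rw [hf_succ, wstep_false h]; ring

theorem cnt_diff_aux (l : Wt N) (i : Fin N) : ∀ (d : ℕ) (h : (i : ℕ) + d < N),
    (cnt l true i ⟨i + d, h⟩ : ℤ) - cnt l false i ⟨i + d, h⟩
      = hf l (i + d + 1) - hf l (i + 1) := by
  intro d
  induction d with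
  | zero =>
    intro h
    have : ∀ b, cnt l b i ⟨i + 0, h⟩ = 0 := by
      intro b
      unfold cnt
      rw [Set.ncard_eq_zero]
      ext t
      simp only [Set.mem_ofPred_eq, Set.mem_empty_iff_false, iff_false, not_and, Fin.lt_def,
        Fin.le_def]
      omega
    rw [this, this]; simp
  | succ d ih =>
    intro h
    have h' : (i : ℕ) + d < N := by omega
    have key : ∀ b, cnt l b i ⟨i + (d + 1), h⟩ = cnt l b i ⟨i + d, h'⟩ +
        (if l ⟨i + (d + 1), h⟩ = b then 1 else 0) := by
      intro b
      unfold cnt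
      split_ifs with hb
      · have : {t : Fin N | i < t ∧ t ≤ ⟨i + (d + 1), h⟩ ∧ l t = b} =
          insert ⟨i + (d + 1), h⟩ {t : Fin N | i < t ∧ t ≤ ⟨i + d, h'⟩ ∧ l t = b} := by
          ext t
          simp only [Set.mem_ofPred_eq, Set.mem_insert_iff, Fin.lt_def, Fin.le_def, Fin.ext_iff]
          constructor
          · rintro ⟨h1, h2, h3⟩
            by_cases ht : (t : ℕ) = i + (d + 1)
            · exact Or.inl ht
            · exact Or.inr ⟨h1, by omega, h3⟩
          · rintro (h1 | ⟨h1, h2, h3⟩)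
            · refine ⟨by omega, by omega, ?_⟩
              rw [← hb]; congr 1; exact Fin.ext h1
            · exact ⟨h1, by omega, h3⟩
        rw [this, Set.ncard_insert_of_notMem]
        simp only [Set.mem_ofPred_eq, Fin.le_def]
        omega
      · congr 1
        ext t
        simp only [Set.mem_ofPred_eq, Fin.lt_def, Fin.le_def]
        constructor
        · rintro ⟨h1, h2, h3⟩
          by_cases ht : (t : ℕ) = i + (d + 1)
          · exfalso; apply hb; rw [← h3]; congr 1; exact Fin.ext ht.symm
          · exact ⟨h1, by omega, h3⟩
        · rintro ⟨h1, h2, h3⟩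
          exact ⟨h1, by omega, h3⟩
    have e := ih h'
    rw [key, key, hf_succ]
    have hw : wstep l (i + (d + 1)) = if l ⟨i + (d + 1), h⟩ = true then 1 else -1 := by
      simp [wstep, h]
    have e2 : (i : ℕ) + (d + 1) = i + d + 1 := by omega
    rw [hw]
    push_cast
    rw [← e2] at e
    cases hl : l ⟨i + (d + 1), h⟩ <;> simp <;> linarith

theorem cnt_diff (l : Wt N) (i k : Fin N) (h : i ≤ k) :
    (cnt l true i k : ℤ) - cnt l false i k = hf l (k + 1) - hf l (i + 1) := by
  have h' : (i : ℕ) ≤ k := h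
  have e : (i : ℕ) + (k - i) = k := by omega
  have h2 := cnt_diff_aux l i (k - i) (by omega)
  simp only [e] at h2
  exact h2

theorem circ_iff (l : Wt N) (i j : Fin N) :
    IsCircle l i j ↔ i < j ∧ hf l (j + 1) = hf l i ∧
      ∀ k : ℕ, (i : ℕ) < k → k ≤ j → hf l i < hf l k := by
  constructor
  · rintro ⟨h1, h2, h3, h4, h5⟩
    have hi := hf_true h2
    refine ⟨h1, ?_, ?_⟩
    · have := cnt_diff l i j h1.le
      omega
    · intro k hk1 hk2
      obtain ⟨k, rfl⟩ : ∃ k', k = k' + 1 := ⟨k - 1, by omega⟩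
      by_cases hk : k = i
      · subst hk; omega
      · have hkN : k < N := by omega
        have := cnt_diff l i ⟨k, hkN⟩ (by rw [Fin.le_def]; simp; omega)
        have := h5 ⟨k, hkN⟩ (by rw [Fin.lt_def]; simp; omega) (by rw [Fin.lt_def]; simp; omega)
        simp only at *
        omega
  · rintro ⟨h1, h2, h3⟩
    have h1' : (i : ℕ) < j := h1
    have hi : l i = true := by
      by_contra hc
      have := hf_false (Bool.not_eq_true _ ▸ hc)
      have := h3 (i + 1) (by omega) (by omega)
      omega
    have hj : l j = false := by
      by_contra hc
      have := hf_true (Bool.not_eq_false _ ▸ hc)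
      have := h3 j (by omega) (by omega)
      omega
    have e1 := hf_true hi
    refine ⟨h1, hi, hj, ?_, ?_⟩
    · have := cnt_diff l i j h1.le
      omega
    · intro k hk1 hk2
      have := cnt_diff l i k hk1.le
      have := h3 (k + 1) (by have : (i : ℕ) < k := hk1; omega)
        (by have : (k : ℕ) < j := hk2; omega)
      omega

theorem circ_lt {l : Wt N} {i j : Fin N} (h : IsCircle l i j) : (i : ℕ) < j := h.1

/-- Circles do not cross. -/
theorem circ_noncross {l : Wt N} {i j i' j' : Fin N} (h : IsCircle l i j)
    (h' : IsCircle l i' j') :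
    (i = i' ∧ j = j') ∨ j < i' ∨ j' < i ∨ (i < i' ∧ j' < j) ∨ (i' < i ∧ j < j') := by
  obtain ⟨a1, a2, a3⟩ := (circ_iff _ _ _).1 h
  obtain ⟨b1, b2, b3⟩ := (circ_iff _ _ _).1 h'
  have e1 := hf_true h.2.1
  have e2 := hf_false h.2.2.1
  have e3 := hf_true h'.2.1
  have e4 := hf_false h'.2.2.1
  simp only [Fin.lt_def, Fin.ext_iff] at *
  by_contra hc
  have c1 := a3 i'
  have c2 := a3 (j' + 1)
  have c4 := b3 i
  have c5 := b3 (j + 1)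
  have c6 : (i : ℕ) = i' → hf l i = hf l i' := by intro h; rw [h]
  have c7 : (j : ℕ) = j' → hf l j = hf l j' := by intro h; rw [h]
  have c8 := a3 j'
  have c9 := b3 j
  have c10 : (i : ℕ) = j' → hf l i = hf l j' := by intro h; rw [h]
  have c11 : (j : ℕ) = i' → hf l j = hf l i' := by intro h; rw [h]
  omega

theorem hf_congr {l l' : Wt N} {i j : ℕ} (h : ∀ t : Fin N, i ≤ t → (t : ℕ) ≤ j → l t = l' t) :
    ∀ d, i + d ≤ j + 1 → hf l (i + d) - hf l i = hf l' (i + d) - hf l' i := by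
  intro d
  induction d with
  | zero => simp
  | succ d ih =>
    intro hd
    have := ih (by omega)
    have e : i + (d + 1) = i + d + 1 := by omega
    rw [e, hf_succ, hf_succ]
    have : wstep l (i + d) = wstep l' (i + d) := by
      unfold wstep
      split_ifs with h1 h2 h3 h3 <;> try rfl
      · exact absurd (h ⟨i + d, h1⟩ (by simp) (by simp; omega) ▸ h2) h3
      · exact absurd (h ⟨i + d, h1⟩ (by simp) (by simp; omega) ▸ h3) h2
    omega

/-- Locality. -/
theorem circ_congr {l l' : Wt N} {i j : Fin N} (hc : IsCircle l i j)
    (h : ∀ t : Fin N, i ≤ t → t ≤ j → l t = l' t) : IsCircle l' i j := by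
  obtain ⟨a1, a2, a3⟩ := (circ_iff _ _ _).1 hc
  have a1' : (i : ℕ) < j := a1
  have key := hf_congr (l := l) (l' := l') (i := i) (j := j)
    (fun t h1 h2 => h t h1 h2)
  rw [circ_iff]
  refine ⟨a1, ?_, ?_⟩
  · have := key (j + 1 - i) (by omega)
    rw [show (i : ℕ) + (j + 1 - i) = j + 1 by omega] at this
    omega
  · intro k h1 h2
    have := key (k - i) (by omega)
    rw [show (i : ℕ) + (k - i) = k by omega] at this
    have := a3 k h1 h2
    omega

/-- Downs inside a circle are matched inside. -/
theorem circ_inside {l : Wt N} {a b x : Fin N} (h : IsCircle l a b) (h1 : a < x) (h2 : x < b)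
    (hx : l x = true) : ∃ y, y < b ∧ IsCircle l x y := by
  obtain ⟨a1, a2, a3⟩ := (circ_iff _ _ _).1 h
  have e1 := hf_true h.2.1
  have e2 := hf_false h.2.2.1
  have e3 := hf_true hx
  simp only [Fin.lt_def] at h1 h2 a1
  have hex : ∃ y : ℕ, (x : ℕ) ≤ y ∧ hf l (y + 1) ≤ hf l x := by
    refine ⟨b - 1, by omega, ?_⟩
    rw [show (b : ℕ) - 1 + 1 = b by omega]
    have := a3 x (by omega) (by omega)
    omega
  have hsp := Nat.find_spec hex
  have hmin := fun m => Nat.find_min (H := hex) (m := m)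
  have hle : Nat.find hex ≤ b - 1 := Nat.find_min' hex (by
    refine ⟨by omega, ?_⟩
    rw [show (b : ℕ) - 1 + 1 = b by omega]
    have := a3 x (by omega) (by omega)
    omega)
  generalize Nat.find hex = y at *
  have hxy : (x : ℕ) ≠ y := by
    intro hh; rw [← hh] at hsp; omega
  have hpos : ∀ k : ℕ, (x : ℕ) < k → k ≤ y → hf l x < hf l k := by
    intro k hk1 hk2
    have := hmin (k - 1) (by omega)
    rw [show k - 1 + 1 = k by omega] at this
    by_contra hh
    exact this ⟨by omega, by omega⟩
  refine ⟨⟨y, by omega⟩, by rw [Fin.lt_def]; simp; omega, ?_⟩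
  rw [circ_iff]
  refine ⟨by rw [Fin.lt_def]; simp; omega, ?_, hpos⟩
  have := hpos y (by omega) le_rfl
  have := hf_succ l y
  have := wstep_bound l y
  simp only
  omega

theorem swapC_left (l : Wt N) (i j : Fin N) : swapC l i j i = l j := by simp [swapC]

theorem swapC_right (l : Wt N) (i j : Fin N) : swapC l i j j = l i := by
  by_cases h : j = i
  · subst h; simp [swapC]
  · simp [swapC, h]

theorem swapC_other (l : Wt N) {i j t : Fin N} (h1 : t ≠ i) (h2 : t ≠ j) :
    swapC l i j t = l t := by simp [swapC, h1, h2]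

theorem hf_swap {l : Wt N} {i j : Fin N} (h : IsCircle l i j) (k : ℕ) :
    hf (swapC l i j) k = if (i : ℕ) < k ∧ k ≤ j then hf l k - 2 else hf l k := by
  have hij := circ_lt h
  induction k with
  | zero => simp [hf]
  | succ k ih =>
    rw [hf_succ, hf_succ, ih]
    by_cases h1 : k = i
    · subst h1
      rw [wstep_true h.2.1, wstep_false (by rw [swapC_left, h.2.2.1])]
      have c : ¬((i : ℕ) < i ∧ (i : ℕ) ≤ j) := by omega
      have c' : ((i : ℕ) < i + 1 ∧ (i : ℕ) + 1 ≤ j) := by omega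
      rw [if_neg c, if_pos c']; ring
    · by_cases h2 : k = j
      · subst h2
        rw [wstep_false h.2.2.1, wstep_true (by rw [swapC_right, h.2.1])]
        have c : ¬((i : ℕ) < j + 1 ∧ (j : ℕ) + 1 ≤ j) := by omega
        have c' : ((i : ℕ) < j ∧ (j : ℕ) ≤ j) := by omega
        rw [if_neg c, if_pos c']; ring
      · have : wstep (swapC l i j) k = wstep l k := by
          unfold wstep
          split
          · rw [swapC_other]
            · exact fun hh => h1 (by rw [← hh])
            · exact fun hh => h2 (by rw [← hh])
          · rfl
        rw [this]
        split_ifs <;> omega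

/-- New circles involve the swapped positions. -/
theorem circ_new {l : Wt N} {a b x y : Fin N} (h : IsCircle l a b)
    (h' : IsCircle (swapC l a b) x y) (hn : ¬ IsCircle l x y) : y = a ∨ x = b := by
  by_contra hcon
  push Not at hcon
  apply hn
  have hs := hf_swap h
  have xa : x ≠ a := by
    rintro rfl
    have := h'.2.1
    rw [swapC_left, h.2.2.1] at this
    simp at this
  have yb : y ≠ b := by
    rintro rfl
    have := h'.2.2.1
    rw [swapC_right, h.2.1] at this
    simp at this
  obtain ⟨a1, a2, a3⟩ := (circ_iff _ _ _).1 h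
  obtain ⟨b1, b2, b3⟩ := (circ_iff _ _ _).1 h'
  have e1 := hf_true h.2.1
  have e2 := hf_false h.2.2.1
  rw [circ_iff]
  refine ⟨b1, ?_, ?_⟩
  · simp only [Fin.lt_def, Fin.ext_iff, ne_eq, hs] at *
    have c1 := b3 (a + 1)
    have c2 := b3 b
    have c3 := a3 x
    have c4 := a3 (y + 1)
    have c5 := b3 a
    split_ifs at * <;> omega
  · intro k h1 h2
    simp only [Fin.lt_def, Fin.ext_iff, ne_eq, hs] at *
    have c0 := b3 k h1 h2
    have c1 := b3 (a + 1)
    have c2 := b3 b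
    have c3 := a3 x
    have c4 := a3 (y + 1)
    have c5 := b3 a
    split_ifs at * <;> omega

end heights

/-! ### The key lemma -/

section keylemma

variable {N : ℕ}

structure NoRed (v : ℕ → Wt N) (a b : ℕ → Fin N) (e : ℕ) : Prop where
  circ : ∀ t, t < e → IsCircle (v t) (a t) (b t)
  step : ∀ t, t < e → v (t + 1) = swapC (v t) (a t) (b t)
  no2 : ∀ t, t + 1 < e → IsCircle (v t) (a (t + 1)) (b (t + 1)) →
    ¬ (Encloses (a t) (b t) (a (t + 1)) (b (t + 1)) ∨
      LeftOf (a t) (b t) (a (t + 1)) (b (t + 1)))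
  no3 : ∀ p q, p + 2 ≤ q → q < e →
    (∀ t, p < t → t < q → ¬ IsCircle (v (t - 1)) (a t) (b t)) →
    (∀ t, p ≤ t → t ≤ q → IsCircle (v t) (a q) (b q)) →
    Encloses (a p) (b p) (a q) (b q) →
    (∀ t, p < t → t < q → LeftOf (a q) (b q) (a t) (b t)) → False

theorem NoRed.agree {v : ℕ → Wt N} {a b : ℕ → Fin N} {e : ℕ} (H : NoRed v a b e)
    (r : ℕ) (x : Fin N) : ∀ d, r + d ≤ e → (∀ u, r ≤ u → u < r + d → x ≠ a u ∧ x ≠ b u) →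
    v (r + d) x = v r x := by
  intro d
  induction d with
  | zero => intro _ _; rfl
  | succ d ih =>
    intro h1 h2
    rw [← Nat.add_assoc, H.step (r + d) (by omega)]
    obtain ⟨h3, h4⟩ := h2 (r + d) (by omega) (by omega)
    rw [swapC_other _ h3 h4]
    exact ih (by omega) (fun u hu hu' => h2 u hu (by omega))

theorem NoRed.agree' {v : ℕ → Wt N} {a b : ℕ → Fin N} {e : ℕ} (H : NoRed v a b e)
    {r s : ℕ} {x : Fin N} (hrs : r ≤ s) (hs : s ≤ e)
    (h : ∀ u, r ≤ u → u < s → x ≠ a u ∧ x ≠ b u) : v s x = v r x := by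
  have := H.agree r x (s - r) (by omega) (fun u h1 h2 => h u h1 (by omega))
  rwa [show r + (s - r) = s by omega] at this

theorem NoRed.after {v : ℕ → Wt N} {a b : ℕ → Fin N} {e : ℕ} (H : NoRed v a b e)
    {t : ℕ} (ht : t < e) {x y : Fin N} (h : IsCircle (v (t + 1)) x y) : ¬ (a t = x ∧ b t = y) := by
  rintro ⟨rfl, rfl⟩
  have h1 := h.2.1
  rw [H.step t ht, swapC_left, (H.circ t ht).2.2.1] at h1
  simp at h1

theorem NoRed.key {v : ℕ → Wt N} {a b : ℕ → Fin N} {e : ℕ} (H : NoRed v a b e) :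
    ∀ k p q : ℕ, q = p + k → 1 ≤ k → q < e →
      (∀ t, p ≤ t → t ≤ q → IsCircle (v t) (a q) (b q)) →
      ¬ (Encloses (a p) (b p) (a q) (b q) ∨ LeftOf (a p) (b p) (a q) (b q)) := by
  intro k
  induction k using Nat.strong_induction_on with
  | _ k IH =>
  intro p q hq hk hqe hcq hrel
  by_cases hk1 : k = 1
  · subst hk1; subst hq
    exact H.no2 p hqe (hcq p le_rfl (by omega)) hrel
  -- inner contradiction
  have inner : ∀ r t, p ≤ r → r < t → t < q → (∀ s, r < s → s < t → b r ≤ a s) →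
      a r ≤ a t → a t < b r → False := by
    intro r t hpr hrt htq hs h1 h2
    have cr := H.circ r (by omega)
    have ct := H.circ t (by omega)
    have hne : a r ≠ a t := by
      intro heq
      have e1 : v t (a t) = v (r + 1) (a t) := by
        apply H.agree' (by omega) (by omega)
        intro u hu1 hu2
        have h3 := hs u (by omega) hu2
        have h4 := circ_lt (H.circ u (by omega))
        have h5 := circ_lt cr
        rw [← heq]
        simp only [Fin.le_def, ne_eq, Fin.ext_iff] at *
        omega
      rw [H.step r (by omega), ← heq, swapC_left, cr.2.2.1, heq, ct.2.1] at e1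
      simp at e1
    have hlt : a r < a t := lt_of_le_of_ne h1 hne
    have hag : ∀ s, r ≤ s → s ≤ t → ∀ x, a r < x → x < b r → v s x = v r x := by
      intro s hs1 hs2 x hx1 hx2
      apply H.agree' hs1 (by omega)
      intro u hu1 hu2
      by_cases hur : u = r
      · subst hur; exact ⟨hx1.ne', hx2.ne⟩
      · have h3 := hs u (by omega) (by omega)
        have h4 := (H.circ u (by omega)).1
        exact ⟨(hx2.trans_le h3).ne, (hx2.trans_le (h3.trans h4.le)).ne⟩
    obtain ⟨y, hy, hcy⟩ := circ_inside cr hlt h2 (by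
      rw [← hag t hrt.le le_rfl _ hlt h2]; exact ct.2.1)
    have hall : ∀ s, r ≤ s → s ≤ t → IsCircle (v s) (a t) y := by
      intro s hs1 hs2
      refine circ_congr hcy (fun x hx1 hx2 => (hag s hs1 hs2 x ?_ ?_).symm)
      · exact hlt.trans_le hx1
      · exact hx2.trans_lt hy
    have hyb : y = b t := by
      have h3 := circ_noncross (hall t hrt.le le_rfl) ct
      have h4 := circ_lt ct
      have h5 := circ_lt hcy
      simp only [Fin.lt_def, Fin.ext_iff] at *
      omega
    subst hyb
    exact IH (t - r) (by omega) r t (by omega) (by omega) (by omega) hall (Or.inl ⟨hlt, hy⟩)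
  have hpq : a p < a q := by
    rcases hrel with h | h
    · exact h.1
    · exact (H.circ p (by omega)).1.trans h
  -- middle circles
  have mid : ∀ t, p < t → t < q → a q < a t := by
    intro t h1 h2
    have h3 := IH (q - t) (by omega) t q (by omega) (by omega) hqe
      (fun s hs1 hs2 => hcq s (by omega) hs2)
    have h4 := H.after (t := t) (by omega) (hcq (t + 1) (by omega) (by omega))
    have h5 := circ_noncross (hcq t h1.le h2.le) (H.circ t (by omega))
    have h6 := circ_lt (H.circ q hqe)
    have h7 := circ_lt (H.circ t (by omega))
    simp only [Encloses, LeftOf, Fin.lt_def, Fin.ext_iff] at *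
    omega
  have chain : ∀ t, p < t → t < q →
      a t = b (t - 1) ∧ ¬ IsCircle (v (t - 1)) (a t) (b t) := by
    intro t
    induction t using Nat.strong_induction_on with
    | _ t IHt =>
    intro h1 h2
    obtain ⟨t, rfl⟩ : ∃ t', t = t' + 1 := ⟨t - 1, by omega⟩
    simp only [Nat.add_sub_cancel]
    -- monotonicity of earlier entries
    have mono : ∀ d r, p ≤ r → r + 1 + d ≤ t → b r ≤ a (r + 1 + d) := by
      intro d
      induction d with
      | zero =>
        intro r hr1 hr2
        exact (IHt (r + 1) (by omega) (by omega) (by omega)).1.symm.le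
      | succ d ih =>
        intro r hr1 hr2
        have h3 := ih r hr1 (by omega)
        have h4 := (IHt (r + 1 + (d + 1)) (by omega) (by omega) (by omega)).1
        rw [h4]
        exact h3.trans (H.circ _ (by omega)).1.le
    have mono' : ∀ r s, p ≤ r → r < s → s ≤ t → b r ≤ a s := by
      intro r s hr hrs hst
      have := mono (s - (r + 1)) r hr (by omega)
      rwa [show r + 1 + (s - (r + 1)) = s by omega] at this
    -- a (t+1) is at least every b r
    have hge : ∀ d r, r + d = t → p ≤ r → a r ≤ a (t + 1) → b t ≤ a (t + 1) := by
      intro d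
      induction d with
      | zero =>
        intro r hr1 hr2 hr3
        simp at hr1
        subst hr1
        by_contra hcon
        exact inner r (r + 1) hr2 (by omega) h2 (fun s _ _ => by omega) hr3 (not_le.1 hcon)
      | succ d ih =>
        intro r hr1 hr2 hr3
        have hb : b r ≤ a (t + 1) := by
          by_contra hcon
          exact inner r (t + 1) hr2 (by omega) h2
            (fun s hs1 hs2 => mono' r s hr2 hs1 (by omega)) hr3 (not_le.1 hcon)
        have h3 := (IHt (r + 1) (by omega) (by omega) (by omega)).1
        simp only [Nat.add_sub_cancel] at h3
        exact ih (r + 1) (by omega) (by omega) (by rw [h3]; exact hb)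
    have hmt := mid (t + 1) h1 h2
    have hbt : b t ≤ a (t + 1) := hge (t - p) p (by omega) le_rfl (hpq.trans hmt).le
    have cct := H.circ t (by omega)
    have cct1 := H.circ (t + 1) (by omega)
    have hnot : ¬ IsCircle (v t) (a (t + 1)) (b (t + 1)) := by
      intro hc
      have h3 := H.no2 t (by omega) hc
      have h5 := circ_noncross cct hc
      have h6 := circ_lt cct
      have h7 := circ_lt cct1
      simp only [Encloses, LeftOf, Fin.lt_def, Fin.ext_iff, Fin.le_def] at *
      omega
    refine ⟨?_, hnot⟩
    have h8 := cct1
    rw [H.step t (by omega)] at h8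
    rcases circ_new cct h8 hnot with h3 | h3
    · have h6 := circ_lt cct
      have h7 := circ_lt cct1
      simp only [Fin.lt_def, Fin.ext_iff, Fin.le_def] at *
      omega
    · exact h3
  have hbp : ∀ d, p + 1 + d < q → b p ≤ a (p + 1 + d) := by
    intro d
    induction d with
    | zero =>
      intro hd
      exact (chain (p + 1) (by omega) hd).1.symm.le
    | succ d ih =>
      intro hd
      have h3 := ih (by omega)
      have h4 := (chain (p + 1 + (d + 1)) (by omega) hd).1
      rw [h4]
      exact h3.trans (H.circ _ (by omega)).1.le
  rcases hrel with hrel | hrel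
  · refine H.no3 p q (by omega) hqe (fun t h1 h2 => (chain t h1 h2).2) hcq hrel ?_
    intro t h1 h2
    have h3 := hbp (t - (p + 1)) (by omega)
    rw [show p + 1 + (t - (p + 1)) = t by omega] at h3
    exact hrel.2.trans_le h3
  · have h3 := (chain (p + 1) (by omega) (by omega)).1
    have h4 := mid (p + 1) (by omega) (by omega)
    simp only [Nat.add_sub_cancel] at h3
    rw [h3] at h4
    exact absurd (h4.trans hrel) (by
      have := (H.circ q hqe).1
      simp only [LeftOf, Fin.lt_def] at *
      omega)

end keylemma

/-! ### Inserting a small circle -/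

section insertion

variable {N : ℕ}

/-- Insert a down-up pair at positions `i`, `i+1`. -/
def ins (i : Fin (N + 1)) (u : Wt N) : Wt (N + 2) := fun t =>
  if h1 : (t : ℕ) < i then u ⟨t, by omega⟩
  else if h2 : (t : ℕ) = i then true
  else if h3 : (t : ℕ) = i + 1 then false
  else u ⟨t - 2, by omega⟩

theorem skip2_val (i : ℕ) (t : Fin N) :
    ((skip2 i t : Fin (N + 2)) : ℕ) = if (t : ℕ) < i then (t : ℕ) else t + 2 := by
  unfold skip2; split_ifs <;> simp

theorem skip2_inj (i : ℕ) {s t : Fin N} : skip2 i s = skip2 i t ↔ s = t := by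
  constructor
  · intro h
    have h2 := congrArg Fin.val h
    rw [skip2_val, skip2_val] at h2
    apply Fin.ext
    split_ifs at h2 <;> omega
  · rintro rfl; rfl

theorem skip2_lt (i : ℕ) {s t : Fin N} : skip2 i s < skip2 i t ↔ s < t := by
  rw [Fin.lt_def, Fin.lt_def, skip2_val, skip2_val]
  split_ifs <;> omega

theorem skip2_surj (i : Fin (N + 1)) {x : Fin (N + 2)} (h1 : x ≠ i.castSucc) (h2 : x ≠ i.succ) :
    ∃ a : Fin N, x = skip2 (i : ℕ) a := by
  simp only [ne_eq, Fin.ext_iff, Fin.val_castSucc, Fin.val_succ] at h1 h2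
  by_cases h : (x : ℕ) < i
  · refine ⟨⟨x, by omega⟩, ?_⟩
    apply Fin.ext
    rw [skip2_val]; simp [h]
  · refine ⟨⟨x - 2, by omega⟩, ?_⟩
    apply Fin.ext
    rw [skip2_val]
    simp only
    rw [if_neg (by omega)]
    omega

theorem skip2_ne_left (i : Fin (N + 1)) (a : Fin N) : skip2 (i : ℕ) a ≠ i.castSucc := by
  intro h
  have h2 := congrArg Fin.val h
  rw [skip2_val] at h2
  simp only [Fin.val_castSucc] at h2
  split_ifs at h2 <;> omega

theorem skip2_ne_right (i : Fin (N + 1)) (a : Fin N) : skip2 (i : ℕ) a ≠ i.succ := by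
  intro h
  have h2 := congrArg Fin.val h
  rw [skip2_val] at h2
  simp only [Fin.val_succ] at h2
  split_ifs at h2 <;> omega

theorem ins_skip (i : Fin (N + 1)) (u : Wt N) (t : Fin N) : ins i u (skip2 (i : ℕ) t) = u t := by
  have h := skip2_val (i : ℕ) t
  unfold ins
  by_cases ht : (t : ℕ) < i
  · rw [if_pos ht] at h
    rw [dif_pos (by omega)]
    congr 1
    exact Fin.ext h
  · rw [if_neg ht] at h
    rw [dif_neg (by omega), dif_neg (by omega), dif_neg (by omega)]
    congr 1
    apply Fin.ext
    simp only
    omega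

theorem ins_left (i : Fin (N + 1)) (u : Wt N) : ins i u i.castSucc = true := by simp [ins]

theorem ins_right (i : Fin (N + 1)) (u : Wt N) : ins i u i.succ = false := by simp [ins]

theorem ins_ext (i : Fin (N + 1)) {x y : Wt (N + 2)} (h1 : x i.castSucc = y i.castSucc)
    (h2 : x i.succ = y i.succ) (h3 : ∀ t : Fin N, x (skip2 (i : ℕ) t) = y (skip2 (i : ℕ) t)) :
    x = y := by
  funext t
  by_cases c1 : t = i.castSucc
  · rw [c1, h1]
  by_cases c2 : t = i.succ
  · rw [c2, h2]
  obtain ⟨s, rfl⟩ := skip2_surj i c1 c2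
  exact h3 s

theorem ins_del (i : Fin (N + 1)) {l : Wt (N + 2)} (h1 : l i.castSucc = true)
    (h2 : l i.succ = false) : ins i (fun t => l (skip2 (i : ℕ) t)) = l := by
  apply ins_ext i
  · rw [ins_left, h1]
  · rw [ins_right, h2]
  · intro t; rw [ins_skip]

theorem ins_inj (i : Fin (N + 1)) : Function.Injective (ins (N := N) i) := by
  intro u w h
  funext t
  rw [← ins_skip i u t, h, ins_skip]

theorem hf_ins (i : Fin (N + 1)) (u : Wt N) (k : ℕ) :
    hf (ins i u) k = if k ≤ i then hf u k else if k = i + 1 then hf u i + 1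
      else hf u (k - 2) := by
  have hi := i.isLt
  induction k with
  | zero => simp [hf]
  | succ k ih =>
    rw [hf_succ, ih]
    rcases lt_trichotomy k i with h | h | h
    · have hw : wstep (ins i u) k = wstep u k := by
        unfold wstep
        rw [dif_pos (by omega), dif_pos (by omega)]
        have : ins i u ⟨k, by omega⟩ = u ⟨k, by omega⟩ := by simp [ins, h]
        rw [this]
      rw [hw, if_pos (by omega), if_pos (by omega), hf_succ]
    · have hw : wstep (ins i u) k = 1 := by
        have := wstep_true (ins_left i u)
        rw [← this]; simp [h]
      rw [hw, if_pos (by omega), if_neg (by omega), if_pos (by omega), h]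
    · by_cases h2 : k = i + 1
      · have hw : wstep (ins i u) k = -1 := by
          have := wstep_false (ins_right i u)
          rw [← this]; simp [h2]
        rw [hw, if_neg (by omega), if_pos (by omega), if_neg (by omega), if_neg (by omega)]
        rw [show k + 1 - 2 = i by omega]; ring
      · have hw : wstep (ins i u) k = wstep u (k - 2) := by
          unfold wstep
          by_cases hk : k < N + 2
          · rw [dif_pos hk, dif_pos (by omega)]
            have : ins i u ⟨k, hk⟩ = u ⟨k - 2, by omega⟩ := by
              unfold ins
              simp only
              rw [dif_neg (by omega), dif_neg (by omega), dif_neg h2]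
            rw [this]
          · rw [dif_neg hk, dif_neg (by omega)]
        rw [hw, if_neg (by omega), if_neg (by omega), if_neg (by omega), if_neg (by omega)]
        rw [show k + 1 - 2 = k - 2 + 1 by omega, hf_succ]

theorem circ_adj {l : Wt (N + 2)} {i : Fin (N + 1)} (h1 : l i.castSucc = true)
    (h2 : l i.succ = false) : IsCircle l i.castSucc i.succ := by
  rw [circ_iff]
  have e1 := hf_true h1
  have e2 := hf_false h2
  simp only [Fin.val_castSucc, Fin.val_succ, Fin.lt_def] at *
  refine ⟨by omega, by omega, ?_⟩
  intro k hk1 hk2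
  have : k = i + 1 := by omega
  subst this
  omega

theorem circ_ins (i : Fin (N + 1)) (u : Wt N) (a b : Fin N) :
    IsCircle (ins i u) (skip2 (i : ℕ) a) (skip2 (i : ℕ) b) ↔ IsCircle u a b := by
  rw [circ_iff, circ_iff, skip2_lt]
  simp only [hf_ins, skip2_val]
  constructor
  · rintro ⟨h1, h2, h3⟩
    have h1' : (a : ℕ) < b := h1
    refine ⟨h1, ?_, ?_⟩
    · by_cases ca : (a : ℕ) < i <;> by_cases cb : (b : ℕ) < i
      · simp only [ca, cb, if_true] at h2
        rw [if_pos (by omega), if_pos (by omega)] at h2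
        exact h2
      · simp only [ca, cb, if_true, if_false] at h2
        rw [if_neg (by omega), if_neg (by omega), if_pos (by omega),
          show (b : ℕ) + 2 + 1 - 2 = b + 1 by omega] at h2
        exact h2
      · omega
      · simp only [ca, cb, if_false] at h2
        rw [if_neg (by omega), if_neg (by omega), if_neg (by omega), if_neg (by omega),
          show (b : ℕ) + 2 + 1 - 2 = b + 1 by omega, show (a : ℕ) + 2 - 2 = a by omega] at h2
        exact h2
    · intro k hk1 hk2
      have h4 := h3 (if k < i + 1 ∧ (a : ℕ) < i then k else k + 2)
        (by split_ifs <;> omega) (by split_ifs <;> omega)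
      by_cases ca : (a : ℕ) < i
      · by_cases ck : k < i + 1
        · simp only [ca, ck, and_self, if_true] at h4
          rw [if_pos (by omega), if_pos (by omega)] at h4
          exact h4
        · simp only [ca, ck, if_true, if_false, false_and] at h4
          rw [if_pos (by omega), if_neg (by omega), if_neg (by omega)] at h4
          exact h4
      · simp only [ca, if_false, and_false] at h4
        rw [if_neg (by omega), if_neg (by omega), if_neg (by omega), if_neg (by omega)] at h4
        exact h4
  · rintro ⟨h1, h2, h3⟩
    have h1' : (a : ℕ) < b := h1
    refine ⟨h1, ?_, ?_⟩
    · by_cases ca : (a : ℕ) < i <;> by_cases cb : (b : ℕ) < i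
      · simp only [ca, cb, if_true]
        rw [if_pos (by omega), if_pos (by omega)]
        exact h2
      · simp only [ca, cb, if_true, if_false]
        rw [if_neg (by omega), if_neg (by omega), if_pos (by omega),
          show (b : ℕ) + 2 + 1 - 2 = b + 1 by omega]
        exact h2
      · omega
      · simp only [ca, cb, if_false]
        rw [if_neg (by omega), if_neg (by omega), if_neg (by omega), if_neg (by omega),
          show (b : ℕ) + 2 + 1 - 2 = b + 1 by omega, show (a : ℕ) + 2 - 2 = a by omega]
        exact h2
    · intro k hk1 hk2
      by_cases ca : (a : ℕ) < i
      · simp only [ca, if_true] at hk1 ⊢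
        rw [if_pos (by omega)]
        by_cases ck : k ≤ i
        · rw [if_pos ck]
          exact h3 k hk1 (by split_ifs at hk2 <;> omega)
        · rw [if_neg ck]
          have cb : ¬ (b : ℕ) < i := by intro cb; rw [if_pos cb] at hk2; omega
          rw [if_neg cb] at hk2
          by_cases ck2 : k = i + 1
          · rw [if_pos ck2]
            have := h3 i (by omega) (by omega)
            omega
          · rw [if_neg ck2]
            by_cases ck3 : k = i + 2
            · rw [show k - 2 = i by omega]
              exact h3 i (by omega) (by omega)
            · exact h3 (k - 2) (by omega) (by omega)
      · have cb : ¬ (b : ℕ) < i := by omega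
        simp only [ca, cb, if_false] at hk1 hk2 ⊢
        rw [if_neg (by omega), if_neg (by omega), if_neg (by omega), if_neg (by omega)]
        exact h3 (k - 2) (by omega) (by omega)

/-- Circles of `ins i u`. -/
theorem circ_ins_cases (i : Fin (N + 1)) (u : Wt N) {x y : Fin (N + 2)}
    (h : IsCircle (ins i u) x y) : (x = i.castSucc ∧ y = i.succ) ∨
      ∃ a b : Fin N, x = skip2 (i : ℕ) a ∧ y = skip2 (i : ℕ) b ∧ IsCircle u a b := by
  have hc := circ_adj (ins_left i u) (ins_right i u)
  by_cases hx : x = i.castSucc ∧ y = i.succ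
  · exact Or.inl hx
  right
  have hn := circ_noncross h hc
  have h1 := circ_lt h
  have hx1 : x ≠ i.castSucc := by
    intro hh
    simp only [Fin.lt_def, Fin.ext_iff, Fin.val_castSucc, Fin.val_succ] at h1 hn hx hh
    omega
  have hx2 : x ≠ i.succ := by
    intro hh
    simp only [Fin.lt_def, Fin.ext_iff, Fin.val_castSucc, Fin.val_succ] at h1 hn hx hh
    omega
  have hy1 : y ≠ i.castSucc := by
    intro hh
    simp only [Fin.lt_def, Fin.ext_iff, Fin.val_castSucc, Fin.val_succ] at h1 hn hx hh
    omega
  have hy2 : y ≠ i.succ := by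
    intro hh
    simp only [Fin.lt_def, Fin.ext_iff, Fin.val_castSucc, Fin.val_succ] at h1 hn hx hh
    omega
  obtain ⟨a, rfl⟩ := skip2_surj i hx1 hx2
  obtain ⟨b, rfl⟩ := skip2_surj i hy1 hy2
  exact ⟨a, b, rfl, rfl, (circ_ins i u a b).1 h⟩

theorem swap_ins (i : Fin (N + 1)) (u : Wt N) (a b : Fin N) :
    swapC (ins i u) (skip2 (i : ℕ) a) (skip2 (i : ℕ) b) = ins i (swapC u a b) := by
  apply ins_ext i
  · rw [swapC_other _ (skip2_ne_left i a).symm (skip2_ne_left i b).symm, ins_left, ins_left]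
  · rw [swapC_other _ (skip2_ne_right i a).symm (skip2_ne_right i b).symm, ins_right, ins_right]
  · intro t
    rw [ins_skip]
    simp only [swapC, skip2_inj, ins_skip]

theorem swap_adj_ne (i : Fin (N + 1)) (u w : Wt N) :
    swapC (ins i u) i.castSucc i.succ ≠ ins i w := by
  intro h
  have := congrFun h i.castSucc
  rw [swapC_left, ins_left, ins_right] at this
  simp at this

theorem swap_ins_cases (i : Fin (N + 1)) (u w : Wt N) {x y : Fin (N + 2)}
    (h : IsCircle (ins i u) x y) (hw : ins i w = swapC (ins i u) x y) :
    ∃ a b : Fin N, x = skip2 (i : ℕ) a ∧ y = skip2 (i : ℕ) b ∧ IsCircle u a b ∧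
      w = swapC u a b := by
  rcases circ_ins_cases i u h with ⟨rfl, rfl⟩ | ⟨a, b, rfl, rfl, hab⟩
  · exact absurd hw.symm (swap_adj_ne i u w)
  · refine ⟨a, b, rfl, rfl, hab, ?_⟩
    rw [swap_ins] at hw
    exact ins_inj i hw

theorem step_ins (i : Fin (N + 1)) (u w : Wt N) :
    GammaStep (ins i u) (ins i w) ↔ GammaStep u w := by
  constructor
  · rintro ⟨x, y, h, hw⟩
    obtain ⟨a, b, -, -, h1, h2⟩ := swap_ins_cases i u w h hw
    exact ⟨a, b, h1, h2⟩
  · rintro ⟨a, b, h, rfl⟩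
    exact ⟨_, _, (circ_ins i u a b).2 h, (swap_ins i u a b).symm⟩

theorem encl_ins (i : ℕ) (a b c d : Fin N) :
    Encloses (skip2 i a) (skip2 i b) (skip2 i c) (skip2 i d) ↔ Encloses a b c d := by
  simp [Encloses, skip2_lt]

theorem left_ins (i : ℕ) (a b c d : Fin N) :
    LeftOf (skip2 i a) (skip2 i b) (skip2 i c) (skip2 i d) ↔ LeftOf a b c d := by
  simp [LeftOf, skip2_lt]

end insertion

/-! ### Heights and potentials -/

section potential

variable {N : ℕ}

/-- Sum of the positions of the downs. -/
def phi (l : Wt N) : ℕ := ∑ t : Fin N, if l t = true then (t : ℕ) else 0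

theorem phi_swap {l : Wt N} {i j : Fin N} (h : IsCircle l i j) :
    phi (swapC l i j) + i = phi l + j := by
  have hij : i ≠ j := h.1.ne
  have e1 : ∀ x : Fin N, (∑ t : Fin N, if t = x then (x : ℕ) else 0) = x := by
    intro x; simp
  have : phi (swapC l i j) + (∑ t : Fin N, if t = i then (i : ℕ) else 0) =
      phi l + (∑ t : Fin N, if t = j then (j : ℕ) else 0) := by
    unfold phi
    rw [← Finset.sum_add_distrib, ← Finset.sum_add_distrib]
    apply Finset.sum_congr rfl
    intro t _
    by_cases h1 : t = i
    · subst h1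
      rw [swapC_left, h.2.1, h.2.2.1]
      simp [hij]
    · by_cases h2 : t = j
      · subst h2
        rw [swapC_right, h.2.1, h.2.2.1]
        simp [hij.symm]
      · rw [swapC_other _ h1 h2]
        simp [h1, h2]
  rwa [e1, e1] at this

theorem phi_step {l l' : Wt N} (h : GammaStep l l') : phi l < phi l' := by
  obtain ⟨i, j, hc, rfl⟩ := h
  have := phi_swap hc
  have := circ_lt hc
  omega

theorem pairs_card (S : Finset (Fin N)) :
    2 * (∑ t ∈ S, (S.filter (· < t)).card) + S.card = S.card * S.card := by
  have h1 : ∑ t ∈ S, (S.filter (· < t)).card = ∑ t ∈ S, ∑ j ∈ S, if j < t then 1 else 0 := by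
    apply Finset.sum_congr rfl
    intro t _
    rw [Finset.card_filter]
  have h2 : ∑ t ∈ S, (S.filter (· < t)).card = ∑ t ∈ S, ∑ j ∈ S, if t < j then 1 else 0 := by
    rw [h1, Finset.sum_comm]
  have h3 : S.card = ∑ t ∈ S, ∑ j ∈ S, if t = j then 1 else 0 := by
    rw [Finset.card_eq_sum_ones]
    apply Finset.sum_congr rfl
    intro t ht
    simp [ht]
  have h4 : S.card * S.card = ∑ t ∈ S, ∑ j ∈ S, 1 := by simp
  rw [two_mul, h4]
  nth_rewrite 1 [h1]
  rw [h2]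
  rw [h3]
  rw [← Finset.sum_add_distrib, ← Finset.sum_add_distrib]
  apply Finset.sum_congr rfl
  intro t _
  rw [← Finset.sum_add_distrib, ← Finset.sum_add_distrib]
  apply Finset.sum_congr rfl
  intro j _
  rcases lt_trichotomy t j with h | h | h
  · simp [h, h.ne, h.le]
  · simp [h]
  · simp [h, h.ne', h.le]

theorem height_phi {m n : ℕ} {l : Wt N} (h : IsWeight m n l) :
    2 * height l + m * m = 2 * phi l + m := by
  set S : Finset (Fin N) := Finset.univ.filter (fun t => l t = true) with hS
  have hm : S.card = m := by
    rw [← h.1, Set.ncard_eq_toFinset_card', Set.toFinset_ofPred]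
  have key : height l + ∑ t ∈ S, (S.filter (· < t)).card = phi l := by
    have e1 : ∑ t ∈ S, (S.filter (· < t)).card =
        ∑ t : Fin N, if l t = true then (S.filter (· < t)).card else 0 := by
      rw [hS, Finset.sum_filter]
    rw [e1]
    unfold height phi
    rw [← Finset.sum_add_distrib]
    apply Finset.sum_congr rfl
    intro t _
    split_ifs with ht
    · have e2 : {j : Fin N | j < t ∧ l j = false}.ncard =
          (Finset.univ.filter (fun j : Fin N => j < t ∧ l j = false)).card := by
        rw [Set.ncard_eq_toFinset_card', Set.toFinset_ofPred]
      have e3 : (Finset.univ.filter (fun j : Fin N => j < t)).card = t := by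
        have : (Finset.univ.filter (fun j : Fin N => j < t)) = Finset.Iio t := by
          ext; simp
        rw [this, Fin.card_Iio]
      rw [e2, ← e3, ← Finset.card_union_of_disjoint]
      · congr 1
        ext j
        simp only [hS, Finset.mem_union, Finset.mem_filter, Finset.mem_univ, true_and]
        cases l j <;> simp
      · rw [Finset.disjoint_left]
        intro j
        simp only [hS, Finset.mem_filter, Finset.mem_univ, true_and]
        rintro ⟨_, h1⟩ ⟨h2, _⟩
        rw [h1] at h2; simp at h2
    · rfl
  have := pairs_card S
  rw [hm] at this
  omega

theorem height_lt_of_phi {m n : ℕ} {l l' : Wt N} (h : IsWeight m n l) (h' : IsWeight m n l')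
    (hp : phi l < phi l') : height l < height l' := by
  have := height_phi h
  have := height_phi h'
  omega

theorem weight_sum {m n : ℕ} {l : Wt N} (h : IsWeight m n l) :
    (∑ t : Fin N, if l t = true then n else 0) = m * n := by
  rw [← Finset.sum_filter, Finset.sum_const, smul_eq_mul, ← h.1,
    Set.ncard_eq_toFinset_card', Set.toFinset_ofPred]

theorem height_le {m n : ℕ} {l : Wt N} (h : IsWeight m n l) : height l ≤ m * n := by
  rw [← weight_sum h]
  unfold height
  apply Finset.sum_le_sum
  intro t _
  split_ifs
  · rw [← h.2]
    exact Set.ncard_le_ncard (fun j hj => hj.2) (Set.toFinite _)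
  · exact le_rfl

theorem no_descent_mono {l : Wt (N + 2)} {s : ℕ}
    (h : ∀ i : Fin (N + 1), s ≤ i → ¬ (l i.castSucc = true ∧ l i.succ = false)) :
    ∀ x y : Fin (N + 2), s ≤ x → x ≤ y → l x = true → l y = true := by
  intro x y hx hxy hl
  obtain ⟨d, hd⟩ : ∃ d : ℕ, (y : ℕ) = x + d := ⟨y - x, by rw [Fin.le_def] at hxy; omega⟩
  induction d generalizing y with
  | zero =>
    have : y = x := Fin.ext (by simpa using hd)
    rw [this]; exact hl
  | succ d ih =>
    have hy := y.isLt
    have h1 := ih ⟨x + d, by omega⟩ (by rw [Fin.le_def]; simp) rfl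
    have h2 := h ⟨x + d, by omega⟩ (by simp; omega)
    have e1 : (Fin.castSucc ⟨(x : ℕ) + d, by omega⟩ : Fin (N + 2)) = ⟨x + d, by omega⟩ := rfl
    have e2 : (Fin.succ ⟨(x : ℕ) + d, by omega⟩ : Fin (N + 2)) = y := by
      apply Fin.ext; simp; omega
    rw [e1, e2] at h2
    by_contra hc
    exact h2 ⟨h1, Bool.not_eq_true _ ▸ hc⟩

theorem exists_descent {m n : ℕ} {l l' : Wt (N + 2)} (h : IsWeight m n l) (h' : IsWeight m n l')
    (hlt : height l < height l') :
    ∃ i : Fin (N + 1), (l i.castSucc = true ∧ l i.succ = false) ∧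
      ∀ i' : Fin (N + 1), l i'.castSucc = true ∧ l i'.succ = false → i' ≤ i := by
  set S : Finset (Fin (N + 1)) :=
    Finset.univ.filter (fun i => l i.castSucc = true ∧ l i.succ = false) with hS
  have hne : S.Nonempty := by
    by_contra hc
    rw [Finset.not_nonempty_iff_eq_empty] at hc
    have hmono := no_descent_mono (l := l) (s := 0) (by
      intro i _ hi
      have : i ∈ S := by simp [hS, hi]
      rw [hc] at this
      simp at this)
    have : height l = m * n := by
      rw [← weight_sum h]
      unfold height
      apply Finset.sum_congr rfl
      intro t _
      split_ifs with ht
      · rw [← h.2]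
        congr 1
        ext j
        simp only [Set.mem_ofPred_eq, and_iff_right_iff_imp]
        intro hj
        by_contra hc
        have := hmono t j (by simp) (not_lt.1 hc) ht
        rw [hj] at this; simp at this
      · rfl
    have := height_le h'
    omega
  refine ⟨S.max' hne, ?_, ?_⟩
  · have := S.max'_mem hne
    simpa [hS] using this
  · intro i' hi'
    exact S.le_max' i' (by simp [hS, hi'])

theorem weight_del {m n : ℕ} {l : Wt (N + 2)} {i : Fin (N + 1)} (h : IsWeight m n l)
    (h1 : l i.castSucc = true) (h2 : l i.succ = false) :
    IsWeight (m - 1) (n - 1) (fun t : Fin N => l (skip2 (i : ℕ) t)) := by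
  have key : ∀ (b : Bool) (x y : Fin (N + 2)), (x = i.castSucc ∧ y = i.succ ∨
      y = i.castSucc ∧ x = i.succ) → l x = b → l y ≠ b →
      {t : Fin (N + 2) | l t = b}.ncard = {t : Fin N | l (skip2 (i : ℕ) t) = b}.ncard + 1 := by
    intro b x y hxy hx hy
    have e : {t : Fin (N + 2) | l t = b} =
        insert x (skip2 (i : ℕ) '' {t : Fin N | l (skip2 (i : ℕ) t) = b}) := by
      ext t
      simp only [Set.mem_ofPred_eq, Set.mem_insert_iff, Set.mem_image]
      constructor
      · intro ht
        by_cases c : t = x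
        · exact Or.inl c
        · right
          have c2 : t ≠ y := by rintro rfl; exact hy ht
          obtain ⟨s, rfl⟩ := skip2_surj i (x := t)
            (by rcases hxy with ⟨rfl, rfl⟩ | ⟨rfl, rfl⟩ <;> assumption)
            (by rcases hxy with ⟨rfl, rfl⟩ | ⟨rfl, rfl⟩ <;> assumption)
          exact ⟨s, ht, rfl⟩
      · rintro (rfl | ⟨s, hs, rfl⟩)
        · exact hx
        · exact hs
    rw [e, Set.ncard_insert_of_notMem, Set.ncard_image_of_injective]
    · intro s t; exact (skip2_inj _).1
    · rintro ⟨s, _, hs⟩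
      rcases hxy with ⟨rfl, rfl⟩ | ⟨rfl, rfl⟩
      · exact skip2_ne_left i s hs
      · exact skip2_ne_right i s hs
  have k1 := key true _ _ (Or.inl ⟨rfl, rfl⟩) h1 (by simp [h2])
  have k2 := key false _ _ (Or.inr ⟨rfl, rfl⟩) h2 (by simp [h1])
  constructor
  · rw [← h.1, k1]; simp
  · rw [← h.2, k2]; simp

end potential

/-! ### Reductions and insertion -/

section reductions

variable {N : ℕ}

theorem eq_ofFn_iff {α : Type*} (p : List α) (k : ℕ) (v : ℕ → α) :
    p = List.ofFn (fun t : Fin (k + 1) => v t.val) ↔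
      p.length = k + 1 ∧ ∀ t, t < k + 1 → p[t]? = some (v t) := by
  constructor
  · rintro rfl
    refine ⟨by simp, fun t ht => ?_⟩
    rw [List.getElem?_eq_getElem (by simpa using ht), List.getElem_ofFn]
  · rintro ⟨h1, h2⟩
    apply List.ext_getElem
    · simp [h1]
    · intro t ht1 ht2
      have := h2 t (by omega)
      rw [List.getElem?_eq_getElem ht1] at this
      rw [List.getElem_ofFn]
      exact Option.some.inj this

theorem st1_map (i : Fin (N + 1)) (p : List (Wt N)) : SType1 (p.map (ins i)) ↔ SType1 p := by
  constructor
  · rintro ⟨x, y, z, hp, h1, h2⟩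
    · obtain ⟨x', y', z', rfl⟩ : ∃ x y z, p = [x, y, z] := by
        have := congrArg List.length hp
        exact List.length_eq_three.1 (by simpa using this)
      simp only [List.map_cons, List.map_nil, List.cons.injEq, and_true] at hp
      obtain ⟨rfl, rfl, rfl⟩ := hp
      exact ⟨x', y', z', rfl, (step_ins i _ _).1 h1, (step_ins i _ _).1 h2⟩
  · rintro ⟨x, y, z, rfl, h1, h2⟩
    exact ⟨_, _, _, rfl, (step_ins i _ _).2 h1, (step_ins i _ _).2 h2⟩

theorem st2_map (i : Fin (N + 1)) (p : List (Wt N)) :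
    SType2Asc (p.map (ins i)) ↔ SType2Asc p := by
  constructor
  · rintro ⟨la, a, b, a', b', h1, h2, h3, h4, hp⟩
    · obtain ⟨x, y, z, rfl⟩ : ∃ x y z, p = [x, y, z] := by
        have := congrArg List.length hp
        exact List.length_eq_three.1 (by simpa using this)
      simp only [List.map_cons, List.map_nil, List.cons.injEq, and_true] at hp
      obtain ⟨rfl, hy, hz⟩ := hp
      rw [← hy] at hz h4
      obtain ⟨c, d, rfl, rfl, hc, rfl⟩ := swap_ins_cases i _ _ h1 hy
      obtain ⟨c', d', rfl, rfl, hc', rfl⟩ := swap_ins_cases i _ _ h4 hz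
      rw [encl_ins, left_ins] at h3
      exact ⟨x, c, d, c', d', hc, (circ_ins i _ _ _).1 h2, h3, hc', rfl⟩
  · rintro ⟨la, a, b, a', b', h1, h2, h3, h4, rfl⟩
    refine ⟨ins i la, skip2 i a, skip2 i b, skip2 i a', skip2 i b', (circ_ins i _ _ _).2 h1,
      (circ_ins i _ _ _).2 h2, ?_, ?_, ?_⟩
    · rwa [encl_ins, left_ins]
    · rw [swap_ins]; exact (circ_ins i _ _ _).2 h4
    · simp [swap_ins]

theorem st3_map (i : Fin (N + 1)) (p : List (Wt N)) :
    SType3Asc (p.map (ins i)) ↔ SType3Asc p := by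
  constructor
  · rintro ⟨k, v, a, b, hk, hp, h1, h2, h3, h4, h5⟩
    rw [eq_ofFn_iff] at hp
    obtain ⟨hlen, hp⟩ := hp
    rw [List.length_map] at hlen
    have hu : ∀ t, t < k + 1 → ins i (p.getD t default) = v t := by
      intro t ht
      have := hp t ht
      rw [List.getElem?_map, List.getElem?_eq_getElem (by omega)] at this
      simp only [Option.map_some, Option.some.injEq] at this
      rw [← this, List.getD_eq_getElem _ _ (by omega)]
    set u : ℕ → Wt N := fun t => p.getD t default with hudef
    have hex : ∀ t, 1 ≤ t → t ≤ k → ∃ c d : Fin N, a t = skip2 (i : ℕ) c ∧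
        b t = skip2 (i : ℕ) d ∧ IsCircle (u (t - 1)) c d ∧ u t = swapC (u (t - 1)) c d := by
      intro t ht1 ht2
      obtain ⟨q1, q2⟩ := h1 t ht1 ht2
      rw [← hu (t - 1) (by omega)] at q1 q2
      rw [← hu t (by omega)] at q2
      exact swap_ins_cases i _ _ q1 q2
    have hex' : ∀ t, ∃ c d : Fin N, 1 ≤ t → t ≤ k → a t = skip2 (i : ℕ) c ∧
        b t = skip2 (i : ℕ) d ∧ IsCircle (u (t - 1)) c d ∧ u t = swapC (u (t - 1)) c d := by
      intro t
      by_cases ht : 1 ≤ t ∧ t ≤ k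
      · obtain ⟨c, d, h⟩ := hex t ht.1 ht.2
        exact ⟨c, d, fun _ _ => h⟩
      · obtain ⟨c, d, h⟩ := hex 1 le_rfl (by omega)
        exact ⟨c, d, fun h1 h2 => absurd ⟨h1, h2⟩ ht⟩
    choose c d hcd using hex'
    refine ⟨k, u, c, d, hk, ?_, ?_, ?_, ?_, ?_, ?_⟩
    · rw [eq_ofFn_iff]
      refine ⟨hlen, fun t ht => ?_⟩
      rw [hudef]
      simp only
      rw [List.getElem?_eq_getElem (by omega), List.getD_eq_getElem _ _ (by omega)]
    · intro t ht1 ht2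
      exact (hcd t ht1 ht2).2.2
    · intro t ht1 ht2 hc
      apply h2 t ht1 ht2
      obtain ⟨e1, e2, -⟩ := hcd t (by omega) (by omega)
      rw [e1, e2, ← hu (t - 2) (by omega)]
      exact (circ_ins i _ _ _).2 hc
    · intro j hj1 hj2
      have := h3 j hj1 hj2
      obtain ⟨e1, e2, -⟩ := hcd k (by omega) (by omega)
      rw [e1, e2, ← hu (j - 1) (by omega)] at this
      exact (circ_ins i _ _ _).1 this
    · obtain ⟨e1, e2, -⟩ := hcd k (by omega) (by omega)
      obtain ⟨e3, e4, -⟩ := hcd 1 (by omega) (by omega)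
      rw [e1, e2, e3, e4, encl_ins] at h4
      exact h4
    · intro t ht1 ht2
      have := h5 t ht1 ht2
      obtain ⟨e1, e2, -⟩ := hcd k (by omega) (by omega)
      obtain ⟨e3, e4, -⟩ := hcd t (by omega) (by omega)
      rw [e1, e2, e3, e4, left_ins] at this
      exact this
  · rintro ⟨k, v, a, b, hk, hp, h1, h2, h3, h4, h5⟩
    refine ⟨k, fun t => ins i (v t), fun t => skip2 i (a t), fun t => skip2 i (b t), hk,
      ?_, ?_, ?_, ?_, ?_, ?_⟩
    · rw [hp, List.map_ofFn]; rfl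
    · intro t ht1 ht2
      obtain ⟨q1, q2⟩ := h1 t ht1 ht2
      refine ⟨(circ_ins i _ _ _).2 q1, ?_⟩
      simp only
      rw [swap_ins, q2]
    · intro t ht1 ht2 hc
      exact h2 t ht1 ht2 ((circ_ins i _ _ _).1 hc)
    · intro j hj1 hj2
      exact (circ_ins i _ _ _).2 (h3 j hj1 hj2)
    · exact (encl_ins _ _ _ _ _).2 h4
    · intro t ht1 ht2
      exact (left_ins _ _ _ _ _).2 (h5 t ht1 ht2)

theorem inS_map (i : Fin (N + 1)) (p : List (Wt N)) : InS (p.map (ins i)) ↔ InS p := by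
  unfold InS
  rw [← List.map_reverse, st1_map, st2_map, st2_map, st3_map, st3_map]

theorem irr_map (i : Fin (N + 1)) (p : List (Wt N)) :
    Irreducible (p.map (ins i)) ↔ Irreducible p := by
  constructor
  · intro h s hs hS
    exact h _ (hs.map _) ((inS_map i s).2 hS)
  · intro h s hs hS
    obtain ⟨x, y, hxy⟩ := hs
    have h1 := hxy.symm
    rw [List.map_eq_append_iff] at h1
    obtain ⟨q1, q2, rfl, h2, h3⟩ := h1
    rw [List.map_eq_append_iff] at h2
    obtain ⟨q3, q4, rfl, h4, rfl⟩ := h2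
    exact h q4 ⟨q3, q2, rfl⟩ ((inS_map i q4).1 hS)

theorem chain_map (i : Fin (N + 1)) (p : List (Wt N)) :
    (p.map (ins i)).IsChain GammaStep ↔ p.IsChain GammaStep := by
  rw [List.isChain_map]
  simp only [step_ins]

/-- On ascending paths only the ascending reductions matter. -/
theorem inS_asc {s : List (Wt N)} (hc : s.IsChain GammaStep) (h : InS s) :
    SType2Asc s ∨ SType3Asc s := by
  have hrev : s.reverse.IsChain (fun x y => GammaStep y x) := by
    rw [List.isChain_reverse]; exact hc
  rcases h with h | h | h | h | h
  · obtain ⟨x, y, z, rfl, h1, h2⟩ := h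
    simp only [List.isChain_cons_cons] at hc
    exact absurd (phi_step h2) (phi_step hc.2.1).not_gt
  · exact Or.inl h
  · obtain ⟨la, a, b, a', b', h1, h2, h3, h4, hp⟩ := h
    rw [hp] at hrev
    simp only [List.isChain_cons_cons] at hrev
    exact absurd (phi_step ⟨_, _, h1, rfl⟩) (phi_step hrev.1).not_gt
  · exact Or.inr h
  · obtain ⟨k, v, a, b, hk, hp, h1, -⟩ := h
    rw [eq_ofFn_iff] at hp
    obtain ⟨hlen, hp⟩ := hp
    have q := (List.isChain_iff_getElem.1 hrev) 0 (by omega)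
    have p0 := hp 0 (by omega)
    have p1 := hp 1 (by omega)
    rw [List.getElem?_eq_getElem (by omega)] at p0 p1
    simp only [Option.some.injEq] at p0 p1
    simp only [Nat.zero_add] at q
    rw [p0, p1] at q
    obtain ⟨r1, r2⟩ := h1 1 le_rfl (by omega)
    exact absurd (phi_step ⟨_, _, r1, r2⟩) (phi_step q).not_gt

end reductions

/-! ### Paths -/

section paths

variable {N : ℕ}

theorem infix_seg (p : List (Wt N)) (r e : ℕ) :
    (p.drop r).take e <:+: p :=
  (List.take_prefix _ _).isInfix.trans (List.drop_suffix _ _).isInfix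

theorem noRed_of_path {p : List (Wt (N + 2))} {e : ℕ} (hlen : p.length = e + 1)
    (hc : p.IsChain GammaStep) (hirr : Irreducible p) :
    ∃ a b : ℕ → Fin (N + 2), NoRed (fun t => p.getD t default) a b e := by
  set v : ℕ → Wt (N + 2) := fun t => p.getD t default with hv
  have hvt : ∀ t, t < e + 1 → p[t]? = some (v t) := by
    intro t ht
    rw [hv]
    simp only
    rw [List.getElem?_eq_getElem (by omega), List.getD_eq_getElem _ _ (by omega)]
  have hseg : ∀ r k, r + k ≤ e →
      (p.drop r).take (k + 1) = List.ofFn (fun t : Fin (k + 1) => v (r + t.val)) := by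
    intro r k hrk
    have := (eq_ofFn_iff ((p.drop r).take (k + 1)) k (fun t => v (r + t))).2
    apply this
    refine ⟨by simp; omega, ?_⟩
    intro t ht
    rw [List.getElem?_take_of_lt ht, List.getElem?_drop]
    exact hvt _ (by omega)
  have hstep : ∀ t, ∃ a b : Fin (N + 2), t < e →
      IsCircle (v t) a b ∧ v (t + 1) = swapC (v t) a b := by
    intro t
    by_cases ht : t < e
    · have q := (List.isChain_iff_getElem.1 hc) t (by omega)
      have p0 := hvt t (by omega)
      have p1 := hvt (t + 1) (by omega)
      rw [List.getElem?_eq_getElem (by omega)] at p0 p1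
      simp only [Option.some.injEq] at p0 p1
      rw [p0, p1] at q
      obtain ⟨a, b, h1, h2⟩ := q
      exact ⟨a, b, fun _ => ⟨h1, h2⟩⟩
    · exact ⟨0, 0, fun h => absurd h ht⟩
  choose a b hab using hstep
  refine ⟨a, b, fun t ht => (hab t ht).1, fun t ht => (hab t ht).2, ?_, ?_⟩
  · intro t ht hcirc hrel
    apply hirr _ (infix_seg p t 3)
    right; left
    obtain ⟨q1, q2⟩ := hab t (by omega)
    obtain ⟨q3, q4⟩ := hab (t + 1) (by omega)
    refine ⟨v t, a t, b t, a (t + 1), b (t + 1), q1, hcirc, hrel, ?_, ?_⟩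
    · rw [← q2]; exact q3
    · rw [hseg t 2 (by omega), ← q2, ← q4]
      simp [List.ofFn_succ]
  · intro r q hrq hqe h1 h2 h3 h4
    apply hirr _ (infix_seg p r (q - r + 1 + 1))
    right; right; right; left
    refine ⟨q - r + 1, fun t => v (r + t), fun t => a (r + t - 1), fun t => b (r + t - 1),
      by omega, hseg r (q - r + 1) (by omega), ?_, ?_, ?_, ?_, ?_⟩
    · intro t ht1 ht2
      have := hab (r + t - 1) (by omega)
      simp only
      rw [show r + t - 1 + 1 = r + t by omega] at this
      rw [show r + (t - 1) = r + t - 1 by omega]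
      exact this
    · intro t ht1 ht2
      have := h1 (r + t - 1) (by omega) (by omega)
      rw [show r + t - 1 - 1 = r + (t - 2) by omega] at this
      exact this
    · intro t ht1 ht2
      have := h2 (r + (t - 1)) (by omega) (by omega)
      simp only
      rw [show r + (q - r + 1) - 1 = q by omega]
      exact this
    · simp only
      rw [show r + (q - r + 1) - 1 = q by omega, show r + 1 - 1 = r by omega]
      exact h3
    · intro t ht1 ht2
      have := h4 (r + t - 1) (by omega) (by omega)
      simp only
      rw [show r + (q - r + 1) - 1 = q by omega]
      exact this

/-- `i` is the rightmost down-up position of `l`. -/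
def Rightmost (l : Wt (N + 2)) (i : Fin (N + 1)) : Prop :=
  (l i.castSucc = true ∧ l i.succ = false) ∧
    ∀ i' : Fin (N + 1), l i'.castSucc = true ∧ l i'.succ = false → i' ≤ i

theorem Rightmost.circ {l : Wt (N + 2)} {i : Fin (N + 1)} (h : Rightmost l i) :
    IsCircle l i.castSucc i.succ := circ_adj h.1.1 h.1.2

theorem Rightmost.not_right {l : Wt (N + 2)} {i : Fin (N + 1)} (h : Rightmost l i)
    {x y : Fin (N + 2)} (hc : IsCircle l x y) : ¬ i.succ < x := by
  intro hx
  have hm := no_descent_mono (l := l) (s := i + 1) (by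
    intro i' hi' hd
    have := h.2 i' hd
    rw [Fin.le_def] at this
    omega) x y (by rw [Fin.lt_def, Fin.val_succ] at hx; omega) hc.1.le hc.2.1
  rw [hc.2.2.1] at hm
  simp at hm

theorem swap_eq_circ {l : Wt N} {a b c d : Fin N} (h1 : IsCircle l a b) (h2 : IsCircle l c d)
    (h : swapC l a b = swapC l c d) : a = c ∧ b = d := by
  have e1 := congrFun h a
  have e2 := congrFun h b
  have n1 := h1.1.ne
  have n2 := h2.1.ne
  have t1 := h1.2.1
  have t2 := h1.2.2.1
  have t3 := h2.2.1
  have t4 := h2.2.2.1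
  rw [swapC_left, t2] at e1
  rw [swapC_right, t1] at e2
  have ac : a = c := by
    by_contra hc
    by_cases had : a = d
    · rw [had, t4] at t1; simp at t1
    · rw [swapC_other _ hc had, t1] at e1; simp at e1
  refine ⟨ac, ?_⟩
  by_contra hbd
  by_cases hbc : b = c
  · rw [hbc, t3] at t2; simp at t2
  · rw [swapC_other _ hbc hbd, t2] at e2; simp at e2

theorem irr_cons {l : Wt (N + 2)} {i : Fin (N + 1)} (h : Rightmost l i)
    {p : List (Wt (N + 2))} (hhead : p.head? = some (swapC l i.castSucc i.succ))
    (hc : p.IsChain GammaStep) (hirr : Irreducible p) : Irreducible (l :: p) := by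
  have hchain : (l :: p).IsChain GammaStep := by
    obtain ⟨p', rfl⟩ : ∃ p', p = swapC l i.castSucc i.succ :: p' := by
      cases p with
      | nil => simp at hhead
      | cons x p' => simp at hhead; exact ⟨p', by rw [hhead]⟩
    rw [List.isChain_cons_cons]
    exact ⟨⟨_, _, h.circ, rfl⟩, hc⟩
  intro s hs hS
  rw [List.infix_cons_iff] at hs
  rcases hs with hs | hs
  · have hS' := inS_asc (hchain.infix hs.isInfix) hS
    have hpre : ∀ (n : ℕ) x, s[n]? = some x → (l :: p)[n]? = some x := by
      intro n x hx
      obtain ⟨t, ht⟩ := hs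
      obtain ⟨hn, -⟩ := List.getElem?_eq_some_iff.1 hx
      rw [← ht, List.getElem?_append_left hn, hx]
    have g0 : ∀ x, s[0]? = some x → x = l := by
      intro x hx
      have := hpre _ x hx
      simpa using this.symm
    have g1 : ∀ x, s[1]? = some x → x = swapC l i.castSucc i.succ := by
      intro x hx
      have := hpre _ x hx
      simp only [List.getElem?_cons_succ, ← List.head?_eq_getElem?, hhead] at this
      simpa using this.symm
    have nocirc : ∀ x y, IsCircle l x y → ¬ Encloses i.castSucc i.succ x y := by
      rintro x y hxy ⟨h1, h2⟩
      have := circ_lt hxy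
      simp only [Fin.lt_def, Fin.val_castSucc, Fin.val_succ] at h1 h2
      omega
    rcases hS' with hS' | hS'
    · obtain ⟨la, a, b, a', b', h1, h2, h3, h4, rfl⟩ := hS'
      obtain rfl := g0 la rfl
      have e := g1 _ rfl
      obtain ⟨rfl, rfl⟩ := swap_eq_circ h1 h.circ e
      rcases h3 with h3 | h3
      · exact nocirc _ _ h2 h3
      · exact h.not_right h2 h3
    · obtain ⟨k, v, a, b, hk, hp, h1, h2, h3, h4, h5⟩ := hS'
      rw [eq_ofFn_iff] at hp
      have e0 := g0 _ (hp.2 0 (by omega))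
      have e1 := g1 _ (hp.2 1 (by omega))
      obtain ⟨r1, r2⟩ := h1 1 le_rfl (by omega)
      have r3 := h3 1 le_rfl (by omega)
      simp only [Nat.sub_self] at r1 r2 r3
      rw [e0] at r1 r2 r3
      rw [e1] at r2
      obtain ⟨q1, q2⟩ := swap_eq_circ r1 h.circ r2.symm
      rw [q1, q2] at h4
      exact nocirc _ _ r3 h4
  · exact hirr s hs hS

/-- A path that does not start with the rightmost small circle never touches it. -/
theorem untouched {l : Wt (N + 2)} {i : Fin (N + 1)} (h : Rightmost l i)
    {v : ℕ → Wt (N + 2)} {a b : ℕ → Fin (N + 2)} {e : ℕ} (H : NoRed v a b e)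
    (h0 : v 0 = l) (h1 : v 1 ≠ swapC l i.castSucc i.succ) :
    ∀ t, t ≤ e → v t i.castSucc = true ∧ v t i.succ = false := by
  intro t
  induction t using Nat.strong_induction_on with
  | _ t IH =>
  intro hte
  rcases Nat.eq_zero_or_pos t with rfl | hpos
  · rw [h0]; exact h.1
  obtain ⟨t, rfl⟩ : ∃ t', t = t' + 1 := ⟨t - 1, by omega⟩
  obtain ⟨q1, q2⟩ := IH t (by omega) (by omega)
  have hct := H.circ t (by omega)
  have hst := H.step t (by omega)
  have hcc := circ_ins_cases i (fun s => v t (skip2 (i : ℕ) s)) (x := a t) (y := b t)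
    (by rw [ins_del i q1 q2]; exact hct)
  rcases hcc with ⟨ha, hb⟩ | ⟨c, d, hc, hd, -⟩
  · exfalso
    rcases Nat.eq_zero_or_pos t with rfl | htpos
    · apply h1
      rw [hst, ha, hb, h0]
    · have hkey := H.key t 0 t (by omega) htpos (by omega) (by
        intro s _ hs
        rw [ha, hb]
        obtain ⟨r1, r2⟩ := IH s (by omega) (by omega)
        exact circ_adj r1 r2)
      apply hkey
      have hc0 := H.circ 0 (by omega)
      have hs0 := H.step 0 (by omega)
      rw [h0] at hc0
      rw [h0] at hs0
      have hn := circ_noncross hc0 h.circ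
      have hnr := h.not_right hc0
      have hlt := circ_lt hc0
      have hne : ¬ (a 0 = i.castSucc ∧ b 0 = i.succ) := by
        rintro ⟨e1, e2⟩
        apply h1
        rw [← e1, ← e2]; exact hs0
      rw [ha, hb]
      simp only [Encloses, LeftOf, Fin.lt_def, Fin.ext_iff, Fin.val_castSucc,
        Fin.val_succ] at *
      omega
  · rw [hst, hc, hd, swapC_other _ (skip2_ne_left i c).symm (skip2_ne_left i d).symm,
      swapC_other _ (skip2_ne_right i c).symm (skip2_ne_right i d).symm]
    exact ⟨q1, q2⟩

/-- The set of ascending irreducible paths. -/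
def PS (k : ℕ) (la mu : Wt N) : Set (List (Wt N)) :=
  {p : List (Wt N) | p.length = k + 1 ∧ p.head? = some la ∧ p.getLast? = some mu ∧
    p.IsChain GammaStep ∧ Irreducible p}

theorem ascCount_eq (k : ℕ) (la mu : Wt N) : ascCount k la mu = (PS k la mu).ncard := rfl

theorem PS_finite (k : ℕ) (la mu : Wt N) : (PS k la mu).Finite :=
  (List.finite_length_eq (Wt N) (k + 1)).subset (fun _ hp => hp.1)

theorem irr_singleton (la : Wt N) : Irreducible [la] := by
  intro s hs hS
  have hl : s.length ≤ 1 := by simpa using hs.length_le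
  have aux2 : ∀ p : List (Wt N), p.length ≤ 1 → ¬ SType2Asc p := by
    rintro p hp ⟨_, _, _, _, _, _, _, _, _, rfl⟩
    simp at hp
  have aux3 : ∀ p : List (Wt N), p.length ≤ 1 → ¬ SType3Asc p := by
    rintro p hp ⟨k, v, _, _, hk, rfl, _⟩
    rw [List.length_ofFn] at hp
    omega
  rcases hS with h | h | h | h | h
  · obtain ⟨x, y, z, rfl, _⟩ := h
    simp at hl
  · exact aux2 _ hl h
  · exact aux2 _ (by simpa using hl) h
  · exact aux3 _ hl h
  · exact aux3 _ (by simpa using hl) h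

theorem PS_zero (la mu : Wt N) : PS 0 la mu = if la = mu then {[la]} else ∅ := by
  ext p
  constructor
  · rintro ⟨h1, h2, h3, -⟩
    obtain ⟨x, rfl⟩ := List.length_eq_one_iff.1 h1
    simp only [List.head?_cons, Option.some.injEq, List.getLast?_singleton] at h2 h3
    rw [if_pos (h2.symm.trans h3), h2]
    rfl
  · split_ifs with h
    · rintro rfl
      subst h
      exact ⟨rfl, rfl, rfl, List.isChain_singleton _, irr_singleton la⟩
    · intro h; exact absurd h (by simp)

theorem chain_phi : ∀ (p : List (Wt N)) (x y : Wt N), p.IsChain GammaStep →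
    p.head? = some x → p.getLast? = some y → p.length = 1 ∨ phi x < phi y := by
  intro p
  induction p with
  | nil => intro x y _ h; simp at h
  | cons a p ih =>
    intro x y hc hx hy
    cases p with
    | nil => left; rfl
    | cons b p =>
      right
      simp only [List.head?_cons, Option.some.injEq] at hx
      subst hx
      rw [List.isChain_cons_cons] at hc
      rw [List.getLast?_cons_cons] at hy
      have hab := phi_step hc.1
      rcases ih b y hc.2 rfl hy with h | h
      · have : p = [] := by simpa using h
        subst this
        simp at hy
        rw [← hy]; exact hab
      · exact hab.trans h

/-- Decomposition of the path set. -/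
theorem PS_decomp {la mu : Wt (N + 2)} {i : Fin (N + 1)} (h : Rightmost la i) (k : ℕ)
    (p : List (Wt (N + 2))) : p ∈ PS (k + 1) la mu ↔
      (∃ p', p = la :: p' ∧ p' ∈ PS k (swapC la i.castSucc i.succ) mu) ∨
      (∃ (p' : List (Wt N)) (mu' : Wt N), p = p'.map (ins i) ∧ mu = ins i mu' ∧
        p' ∈ PS (k + 1) (fun t => la (skip2 (i : ℕ) t)) mu') := by
  constructor
  · rintro ⟨h1, h2, h3, h4, h5⟩
    by_cases hs : p.getD 1 default = swapC la i.castSucc i.succ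
    · left
      match p with
      | [] => simp at h1
      | [x] => simp at h1
      | x :: y :: p =>
        simp only [List.head?_cons, Option.some.injEq] at h2
        subst h2
        refine ⟨y :: p, rfl, by simpa using h1, ?_, ?_, ?_, ?_⟩
        · simpa using hs
        · rwa [List.getLast?_cons_cons] at h3
        · exact (List.isChain_cons_cons.1 h4).2
        · intro s hs'
          exact h5 s (hs'.trans (List.suffix_cons _ _).isInfix)
    · right
      obtain ⟨a, b, H⟩ := noRed_of_path h1 h4 h5
      have hu := untouched h H (by
        match p, h2 with
        | x :: p, h2 => simpa using h2) hs
      have hmem : ∀ w ∈ p, w i.castSucc = true ∧ w i.succ = false := by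
        intro w hw
        obtain ⟨t, ht, rfl⟩ := List.getElem_of_mem hw
        have := hu t (by omega)
        rwa [List.getD_eq_getElem _ _ ht] at this
      have hp : (p.map (fun w => fun t : Fin N => w (skip2 (i : ℕ) t))).map (ins i) = p := by
        rw [List.map_map]
        conv_rhs => rw [← List.map_id p]
        apply List.map_congr_left
        intro w hw
        obtain ⟨q1, q2⟩ := hmem w hw
        exact ins_del i q1 q2
      have hmu := hmem mu (List.mem_of_getLast? h3)
      refine ⟨p.map (fun w => fun t : Fin N => w (skip2 (i : ℕ) t)),
        fun t => mu (skip2 (i : ℕ) t), hp.symm, (ins_del i hmu.1 hmu.2).symm, ?_, ?_, ?_, ?_, ?_⟩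
      · simpa using h1
      · rw [List.head?_map, h2]; rfl
      · rw [List.getLast?_map, h3]; rfl
      · rw [← chain_map i, hp]; exact h4
      · rw [← irr_map i, hp]; exact h5
  · rintro (⟨p', rfl, h1, h2, h3, h4, h5⟩ | ⟨p', mu', rfl, rfl, h1, h2, h3, h4, h5⟩)
    · refine ⟨by simp [h1], rfl, ?_, ?_, irr_cons h h2 h4 h5⟩
      · cases p' with
        | nil => simp at h1
        | cons x p' => rwa [List.getLast?_cons_cons]
      · cases p' with
        | nil => simp at h1
        | cons x p' =>
          simp only [List.head?_cons, Option.some.injEq] at h2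
          rw [List.isChain_cons_cons]
          exact ⟨⟨_, _, h.circ, h2⟩, h4⟩
    · refine ⟨by simp [h1], ?_, ?_, (chain_map i _).2 h4, (irr_map i _).2 h5⟩
      · rw [List.head?_map, h2]
        simp only [Option.map_some]
        rw [ins_del i h.1.1 h.1.2]
      · rw [List.getLast?_map, h3]; rfl

theorem asc_succ_pos {la mu : Wt (N + 2)} {i : Fin (N + 1)} (h : Rightmost la i) (k : ℕ)
    (hmu : mu i.castSucc = true ∧ mu i.succ = false) :
    ascCount (k + 1) la mu = ascCount (k + 1) (fun t => la (skip2 (i : ℕ) t))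
      (fun t => mu (skip2 (i : ℕ) t)) + ascCount k (swapC la i.castSucc i.succ) mu := by
  simp only [ascCount_eq]
  have e : PS (k + 1) la mu = (List.map (ins i)) '' (PS (k + 1) (fun t => la (skip2 (i : ℕ) t))
      (fun t => mu (skip2 (i : ℕ) t))) ∪
      (List.cons la) '' (PS k (swapC la i.castSucc i.succ) mu) := by
    ext p
    rw [PS_decomp h k p]
    constructor
    · rintro (⟨p', rfl, hp⟩ | ⟨p', mu', rfl, rfl, hp⟩)
      · exact Or.inr ⟨p', hp, rfl⟩
      · left
        refine ⟨p', ?_, rfl⟩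
        simp only [ins_skip]
        exact hp
    · rintro (⟨p', hp, rfl⟩ | ⟨p', hp, rfl⟩)
      · right
        exact ⟨p', _, rfl, (ins_del i hmu.1 hmu.2).symm, hp⟩
      · exact Or.inl ⟨p', rfl, hp⟩
  rw [e, Set.ncard_union_eq _ ((PS_finite _ _ _).image _) ((PS_finite _ _ _).image _),
    Set.ncard_image_of_injective _ (List.map_injective_iff.2 (ins_inj i)),
    Set.ncard_image_of_injective _ (List.cons_injective)]
  rw [Set.disjoint_left]
  rintro _ ⟨p', hp, rfl⟩ ⟨p'', hp'', heq⟩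
  match p', hp.1, p'', hp''.2.1 with
  | x :: y :: p', _, z :: p'', hz =>
    simp only [List.head?_cons, Option.some.injEq] at hz
    simp only [List.map_cons, List.cons.injEq] at heq
    have hx := heq.2.1
    rw [hz, heq.1] at hx
    exact swap_adj_ne i x y hx
  | [_], hl, _, _ => simp at hl

theorem asc_succ_neg {la mu : Wt (N + 2)} {i : Fin (N + 1)} (h : Rightmost la i) (k : ℕ)
    (hmu : ¬ (mu i.castSucc = true ∧ mu i.succ = false)) :
    ascCount (k + 1) la mu = ascCount k (swapC la i.castSucc i.succ) mu := by
  simp only [ascCount_eq]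
  have e : PS (k + 1) la mu = (List.cons la) '' (PS k (swapC la i.castSucc i.succ) mu) := by
    ext p
    rw [PS_decomp h k p]
    constructor
    · rintro (⟨p', rfl, hp⟩ | ⟨p', mu', rfl, rfl, hp⟩)
      · exact ⟨p', hp, rfl⟩
      · exact absurd ⟨ins_left i mu', ins_right i mu'⟩ hmu
    · rintro ⟨p', hp, rfl⟩
      exact Or.inl ⟨p', rfl, hp⟩
  rw [e, Set.ncard_image_of_injective _ (List.cons_injective)]

theorem asc_zero_ne {la mu : Wt N} (h : la ≠ mu) : ascCount 0 la mu = 0 := by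
  rw [ascCount_eq, PS_zero, if_neg h]; simp

theorem asc_zero_self (la : Wt N) : ascCount 0 la la = 1 := by
  rw [ascCount_eq, PS_zero, if_pos rfl]; simp

theorem asc_succ_zero {la mu : Wt N} (h : phi mu ≤ phi la) (k : ℕ) :
    ascCount (k + 1) la mu = 0 := by
  rw [ascCount_eq, Set.ncard_eq_zero (PS_finite _ _ _)]
  ext p
  simp only [Set.mem_empty_iff_false, iff_false]
  rintro ⟨h1, h2, h3, h4, -⟩
  rcases chain_phi p la mu h4 h2 h3 with h | h <;> omega

end paths

/-- The Kazhdan–Lusztig polynomials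
`P_{λ,μ}(q) = Σ_k a_k(λ,μ) q^k`, where `a_k(λ,μ)` is the number of ascending
irreducible paths of length `k` from `λ` to `μ`, satisfy the stated recursion.
The deletion of the two positions `i`, `i+1` is realized by composing with `skip2 i`. -/
theorem statement10
    (P : (N : ℕ) → Wt N → Wt N → Polynomial ℤ)
    (hP : ∀ (N : ℕ) (la mu : Wt N) (k : ℕ),
      (P N la mu).coeff k = (ascCount k la mu : ℤ)) :
    (∀ (N m n : ℕ) (la mu : Wt N), IsWeight m n la → IsWeight m n mu →
      (la = mu → P N la mu = 1) ∧
      (la ≠ mu → height mu ≤ height la → P N la mu = 0)) ∧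
    (∀ (N m n : ℕ), 1 ≤ m → 1 ≤ n → N + 2 = m + n →
      ∀ la mu : Wt (N + 2), IsWeight m n la → IsWeight m n mu →
        height la < height mu →
        ∃ i : Fin (N + 1),
          (la i.castSucc = true ∧ la i.succ = false) ∧
          (∀ i' : Fin (N + 1), la i'.castSucc = true ∧ la i'.succ = false → i' ≤ i) ∧
          IsWeight (m - 1) (n - 1) (fun t : Fin N => la (skip2 (i : ℕ) t)) ∧
          ((mu i.castSucc = true ∧ mu i.succ = false) →
            IsWeight (m - 1) (n - 1) (fun t : Fin N => mu (skip2 (i : ℕ) t)) ∧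
            P (N + 2) la mu =
              P N (fun t : Fin N => la (skip2 (i : ℕ) t))
                  (fun t : Fin N => mu (skip2 (i : ℕ) t)) +
                Polynomial.X * P (N + 2) (swapC la i.castSucc i.succ) mu) ∧
          (¬ (mu i.castSucc = true ∧ mu i.succ = false) →
            P (N + 2) la mu =
              Polynomial.X * P (N + 2) (swapC la i.castSucc i.succ) mu)) := by
  refine ⟨?_, ?_⟩
  · intro N m n la mu hla hmu
    refine ⟨?_, ?_⟩
    · rintro rfl
      ext k
      rw [hP, Polynomial.coeff_one]
      cases k with
      | zero => rw [asc_zero_self]; simp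
      | succ k => rw [asc_succ_zero le_rfl]; simp
    · intro hne hle
      ext k
      rw [hP, Polynomial.coeff_zero]
      cases k with
      | zero => rw [asc_zero_ne hne]; simp
      | succ k =>
        rw [asc_succ_zero]
        · simp
        · by_contra hc
          have := height_lt_of_phi hla hmu (not_le.1 hc)
          omega
  · intro N m n _ _ _ la mu hla hmu hlt
    have hne : la ≠ mu := by rintro rfl; exact absurd hlt (lt_irrefl _)
    obtain ⟨i, h1, h2⟩ := exists_descent hla hmu hlt
    have hR : Rightmost la i := ⟨h1, h2⟩
    refine ⟨i, h1, h2, weight_del hla h1.1 h1.2, ?_, ?_⟩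
    · intro hm
      refine ⟨weight_del hmu hm.1 hm.2, ?_⟩
      ext k
      rw [Polynomial.coeff_add]
      cases k with
      | zero =>
        rw [Polynomial.coeff_X_mul_zero, hP, hP, asc_zero_ne hne, asc_zero_ne]
        · simp
        · intro he
          apply hne
          rw [← ins_del i h1.1 h1.2, ← ins_del i hm.1 hm.2, he]
      | succ k =>
        rw [Polynomial.coeff_X_mul, hP, hP, hP, asc_succ_pos hR k hm]
        push_cast
        rfl
    · intro hm
      ext k
      cases k with
      | zero => rw [Polynomial.coeff_X_mul_zero, hP, asc_zero_ne hne]; simp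
      | succ k => rw [Polynomial.coeff_X_mul, hP, hP, asc_succ_neg hR k hm]

end Kh
end

section
/- For all weights λ and μ of type (m,n), the total number of irreducible paths from λ to μ in Q̄_m^n equals the sum over all weights κ of type (m,n) of P_{κ,λ}(1)·P_{κ,μ}(1). -/
open scoped Classical

namespace Kh

variable {N : ℕ}

theorem step_lt {x y : Wt N} (h : GammaStep x y) : toLex y < toLex x := by
  obtain ⟨i, j, ⟨hij, hi, hj, -, -⟩, rfl⟩ := h
  refine ⟨i, ?_, ?_⟩
  · intro k hk
    have h1 : k ≠ i := hk.ne
    have h2 : k ≠ j := (hk.trans hij).ne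
    simp [swapC, h1, h2]
  · simp [swapC, hi, hj]

theorem step_asymm {x y : Wt N} (h : GammaStep x y) (h' : GammaStep y x) : False :=
  lt_asymm (step_lt h) (step_lt h')

theorem step_weight {m n : ℕ} {x y : Wt N} (h : GammaStep x y) :
    IsWeight m n x ↔ IsWeight m n y := by
  obtain ⟨i, j, -, rfl⟩ := h
  have key : ∀ b : Bool, {t : Fin N | swapC x i j t = b}.ncard = {t : Fin N | x t = b}.ncard := by
    intro b
    have hs : ∀ t, swapC x i j t = x (Equiv.swap i j t) := by
      intro t
      unfold swapC
      rw [Equiv.swap_apply_def]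
      split_ifs <;> rfl
    have : {t : Fin N | x t = b} = (Equiv.swap i j) '' {t : Fin N | swapC x i j t = b} := by
      ext t
      simp only [Set.mem_image, Set.mem_setOf_eq]
      constructor
      · intro ht
        exact ⟨Equiv.swap i j t, by rw [hs]; simpa using ht, by simp⟩
      · rintro ⟨u, hu, rfl⟩
        rw [← hs]; exact hu
    rw [this, Set.ncard_image_of_injective _ (Equiv.injective _)]
  simp only [IsWeight, key]

theorem chain_rel {p : List (Wt N)} {x : Wt N} (h : (x :: p).IsChain GammaStep) :
    ∀ y ∈ p, toLex y < toLex x := by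
  have h2 : (x :: p).IsChain (fun a b : Wt N => toLex b < toLex a) :=
    h.imp (fun _ _ h => step_lt h)
  haveI : IsTrans (Wt N) (fun a b : Wt N => toLex b < toLex a) :=
    ⟨fun _ _ _ h1 h2 => lt_trans h2 h1⟩
  have h3 := List.isChain_iff_pairwise.1 h2
  exact (List.pairwise_cons.1 h3).1

theorem chain_nodup {p : List (Wt N)} (h : p.IsChain GammaStep) : p.Nodup := by
  induction p with
  | nil => simp
  | cons x p ih =>
    refine List.nodup_cons.2 ⟨fun hx => lt_irrefl _ (chain_rel h x hx), ih h.tail⟩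

theorem chain_weight {m n : ℕ} {p : List (Wt N)} (h : p.IsChain GammaStep) {x y : Wt N}
    (hx : p.head? = some x) (hy : p.getLast? = some y) : IsWeight m n x ↔ IsWeight m n y := by
  induction p generalizing x with
  | nil => simp at hx
  | cons a p ih =>
    cases p with
    | nil => simp at hx hy; subst hx; subst hy; rfl
    | cons b p =>
      simp at hx; subst hx
      rw [List.isChain_cons_cons] at h
      rw [step_weight h.1]
      exact ih h.2 (by simp) (by simpa using hy)

theorem type2_chain {p : List (Wt N)} (h : SType2Asc p) : p.IsChain GammaStep := by
  obtain ⟨la, i, j, i', j', h1, h2, h3, h4, rfl⟩ := h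
  simp only [List.isChain_cons_cons, List.isChain_singleton, and_true]
  exact ⟨⟨i, j, h1, rfl⟩, ⟨i', j', h4, rfl⟩⟩

theorem type3_chain {p : List (Wt N)} (h : SType3Asc p) : p.IsChain GammaStep := by
  obtain ⟨k, v, a, b, hk, rfl, h1, -⟩ := h
  rw [List.isChain_iff_getElem]
  intro i hi
  simp only [List.length_ofFn] at hi
  simp only [List.getElem_ofFn]
  have := h1 (i+1) (by omega) (by omega)
  exact ⟨a (i+1), b (i+1), this.1, this.2⟩

theorem inS_reverse {p : List (Wt N)} (h : InS p) : InS p.reverse := by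
  rcases h with h | h | h | h | h
  · obtain ⟨x, y, z, rfl, h1, h2⟩ := h
    exact Or.inl ⟨z, y, x, by simp, h2, h1⟩
  · exact Or.inr (Or.inr (Or.inl (by simpa using h)))
  · exact Or.inr (Or.inl h)
  · exact Or.inr (Or.inr (Or.inr (Or.inr (by simpa using h))))
  · exact Or.inr (Or.inr (Or.inr (Or.inl h)))

theorem irr_reverse {p : List (Wt N)} (h : Irreducible p) : Irreducible p.reverse := by
  intro s hs hS
  refine h s.reverse ?_ (inS_reverse hS)
  rw [← List.reverse_infix]
  simpa using hs

theorem irr_infix {p q : List (Wt N)} (h : Irreducible p) (hq : q <:+: p) : Irreducible q :=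
  fun s hs => h s (hs.trans hq)

theorem irr_concat {d b : List (Wt N)} {k : Wt N}
    (hd : (k :: d).IsChain GammaStep) (hb : (k :: b).IsChain GammaStep)
    (id : Irreducible (k :: d)) (ib : Irreducible (k :: b)) :
    Irreducible (d.reverse ++ k :: b) := by
  have id' := irr_reverse id
  simp only [List.reverse_cons] at id'
  rintro s ⟨u, v, huv⟩ hS
  rw [List.append_assoc, List.append_eq_append_iff] at huv
  rcases huv with ⟨c, hc, hs⟩ | ⟨c, hc, hs⟩
  · have hs' : s ++ v = (c ++ [k]) ++ b := by simpa using hs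
    rw [List.append_eq_append_iff] at hs'
    rcases hs' with ⟨e, he, hv⟩ | ⟨e, he, hv⟩
    · exact id' s ⟨u, e, by rw [hc]; simp [he]⟩ hS
    · rcases List.eq_nil_or_concat c with rfl | ⟨c', x, rfl⟩
      · exact ib s ⟨[], v, by simp [he, hv]⟩ hS
      rcases e with _ | ⟨y, e⟩
      · exact id' s ⟨u, [], by rw [hc]; simp [he]⟩ hS
      have hx : GammaStep k x := by
        have : d = x :: (c'.reverse ++ u.reverse) := by
          have := congrArg List.reverse hc
          simpa using this
        rw [this, List.isChain_cons_cons] at hd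
        exact hd.1
      have hy : GammaStep k y := by
        rw [hv, List.cons_append, List.isChain_cons_cons] at hb
        exact hb.1
      have e1 : s = c' ++ ([x, k, y] ++ e) := by simp [he]
      have e2 : s.reverse = e.reverse ++ ([y, k, x] ++ c'.reverse) := by simp [he]
      have up : s.IsChain GammaStep → False := by
        intro h
        rw [e1] at h
        have := h.right_of_append.left_of_append
        rw [List.isChain_cons_cons] at this
        exact step_asymm this.1 hx
      have dn : s.reverse.IsChain GammaStep → False := by
        intro h
        rw [e2] at h
        have := h.right_of_append.left_of_append
        rw [List.isChain_cons_cons] at this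
        exact step_asymm this.1 hy
      rcases hS with h | h | h | h | h
      · obtain ⟨x', y', z', h0, h1, h2⟩ := h
        have hl : c'.length + (e.length + 3) = 3 := by
          have := congrArg List.length (e1.symm.trans h0)
          simpa using this
        have hc0 : c' = [] := List.length_eq_zero_iff.1 (by omega)
        subst hc0
        rw [h0] at e1
        simp at e1
        obtain ⟨rfl, rfl, -⟩ := e1
        exact step_asymm h1 hx
      · exact up (type2_chain h)
      · exact dn (type2_chain h)
      · exact up (type3_chain h)
      · exact dn (type3_chain h)
  · exact ib s ⟨c, v, by rw [hs]; simp⟩ hS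

theorem decomp {w : List (Wt N)} (hw : w ≠ []) (hc : w.IsChain GammaAdj) (hi : Irreducible w) :
    ∃ k d b, w = d.reverse ++ k :: b ∧ (k :: d).IsChain GammaStep ∧
      (k :: b).IsChain GammaStep := by
  induction w with
  | nil => exact absurd rfl hw
  | cons x w ih =>
    cases w with
    | nil => exact ⟨x, [], [], by simp, by simp, by simp⟩
    | cons y w =>
      rw [List.isChain_cons_cons] at hc
      obtain ⟨k, d, b, hw', hd, hb⟩ := ih (by simp) hc.2 (irr_infix hi ⟨[x], [], by simp⟩)
      rcases hc.1 with hxy | hyx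
      · rcases List.eq_nil_or_concat d with rfl | ⟨d', y', rfl⟩
        · simp at hw'
          obtain ⟨rfl, rfl⟩ := hw'
          exact ⟨x, [], y :: w, by simp, by simp, by
            rw [List.isChain_cons_cons]; exact ⟨hxy, hb⟩⟩
        · exfalso
          simp at hw'
          obtain ⟨rfl, hw'⟩ := hw'
          rcases List.eq_nil_or_concat d' with rfl | ⟨d'', z, rfl⟩
          · simp at hw' hd
            refine hi [x, y, k] ⟨[], b, by simp [hw']⟩ (Or.inl ⟨x, y, k, rfl, hxy, hd⟩)
          · have hz : GammaStep z y := by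
              have e : k :: (d'' ++ [z] ++ [y]) = (k :: d'') ++ [z, y] := by simp
              simp only [List.concat_eq_append] at hd
              rw [e] at hd
              simpa using hd.right_of_append
            refine hi [x, y, z] ⟨[], d''.reverse ++ k :: b, by simp [hw']⟩
              (Or.inl ⟨x, y, z, rfl, hxy, hz⟩)
      · refine ⟨k, d ++ [x], b, by simp [hw'], ?_, hb⟩
        rw [← List.cons_append]
        refine List.IsChain.append hd (by simp) ?_
        intro u hu v hv
        simp at hv
        subst hv
        have : (k :: d).getLast? = some y := by
          have h := congrArg List.head? hw'
          rw [← List.head?_reverse]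
          have e : (d.reverse ++ k :: b) = (k :: d).reverse ++ b := by simp
          rw [e, List.head?_append_of_ne_nil _ (by simp)] at h
          simpa using h.symm
        rw [this] at hu
        simp at hu
        subst hu
        exact hyx

/-- The set of all ascending irreducible paths from `ka` to `la`. -/
def ascSet (ka la : Wt N) : Set (List (Wt N)) :=
  {p | p.head? = some ka ∧ p.getLast? = some la ∧ p.IsChain GammaStep ∧ Irreducible p}

theorem ascSet_finite (ka la : Wt N) : (ascSet ka la).Finite := by
  refine (List.finite_length_le (Wt N) (Fintype.card (Wt N))).subset ?_
  rintro p ⟨-, -, h, -⟩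
  exact (chain_nodup h).length_le_card

theorem eval_eq {ka la : Wt N} {P : Polynomial ℤ}
    (hP : ∀ k, P.coeff k = (ascCount k ka la : ℤ)) :
    P.eval 1 = ((ascSet ka la).ncard : ℤ) := by
  set M := max (P.natDegree + 1) (Fintype.card (Wt N))
  rw [Polynomial.eval_eq_sum_range' (n := M) (by omega)]
  simp only [one_pow, mul_one, hP]
  rw [← Nat.cast_sum]
  congr 1
  rw [Set.ncard_eq_toFinset_card _ (ascSet_finite ka la)]
  rw [Finset.card_eq_sum_card_fiberwise (f := fun p => p.length - 1) (t := Finset.range M)]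
  · refine Finset.sum_congr rfl fun k _ => ?_
    rw [ascCount, ← Set.ncard_coe_finset]
    congr 1
    ext p
    simp only [Set.mem_setOf_eq, Finset.coe_filter, Set.Finite.mem_toFinset, ascSet]
    constructor
    · rintro ⟨h1, h2⟩
      exact ⟨h2, by omega⟩
    · rintro ⟨h2, h1⟩
      refine ⟨?_, h2⟩
      have : p ≠ [] := by rintro rfl; simp at h2
      have := List.length_pos_iff.2 this
      omega
  · intro p hp
    simp only [Set.Finite.coe_toFinset] at hp
    have h1 := (chain_nodup hp.2.2.1).length_le_card
    have : p ≠ [] := by rintro rfl; simp [ascSet] at hp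
    have := List.length_pos_iff.2 this
    simp only [Finset.coe_range, Set.mem_Iio]
    omega

/-- The set of irreducible paths. -/
def irrSet (la mu : Wt N) : Set (List (Wt N)) :=
  {p | p ≠ [] ∧ p.head? = some la ∧ p.getLast? = some mu ∧
    p.IsChain GammaAdj ∧ Irreducible p}

theorem ascSet_cons {ka la : Wt N} {p : List (Wt N)} (h : p ∈ ascSet ka la) :
    p = ka :: p.tail := by
  cases p with
  | nil => simp [ascSet] at h
  | cons a p => have := h.1; simp at this; simp [this]

theorem head_rev (k : Wt N) (d b : List (Wt N)) :
    (d.reverse ++ k :: b).head? = (k :: d).getLast? := by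
  have e : (d.reverse ++ k :: b) = (k :: d).reverse ++ b := by simp
  rw [e, List.head?_append_of_ne_nil _ (by simp), List.head?_reverse]

theorem last_rev (k : Wt N) (d b : List (Wt N)) :
    (d.reverse ++ k :: b).getLast? = (k :: b).getLast? :=
  List.getLast?_append_of_ne_nil _ (by simp)

theorem glue_mem {k la mu : Wt N} {d b : List (Wt N)} (hd : (k :: d) ∈ ascSet k la)
    (hb : (k :: b) ∈ ascSet k mu) : d.reverse ++ k :: b ∈ irrSet la mu := by
  obtain ⟨-, d1, d2, d3⟩ := hd
  obtain ⟨-, b1, b2, b3⟩ := hb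
  refine ⟨by simp, by rw [head_rev, d1], by rw [last_rev, b1], ?_, irr_concat d2 b2 d3 b3⟩
  have h1 : (d.reverse ++ [k]).IsChain GammaAdj := by
    rw [← List.reverse_cons, List.isChain_reverse]
    exact d2.imp (fun _ _ h => Or.inr h)
  have h2 : (k :: b).IsChain GammaAdj := b2.imp (fun _ _ h => Or.inl h)
  rw [List.isChain_split]
  exact ⟨h1, h2⟩

theorem glue_inj {k k' : Wt N} {d b d' b' : List (Wt N)}
    (hd : (k :: d).IsChain GammaStep) (hb : (k :: b).IsChain GammaStep)
    (hd' : (k' :: d').IsChain GammaStep) (hb' : (k' :: b').IsChain GammaStep)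
    (h : d.reverse ++ k :: b = d'.reverse ++ k' :: b') : k = k' ∧ d = d' ∧ b = b' := by
  have hk : k = k' := by
    have m1 : k' ∈ d.reverse ++ k :: b := by rw [h]; simp
    have m2 : k ∈ d'.reverse ++ k' :: b' := by rw [← h]; simp
    simp only [List.mem_append, List.mem_reverse, List.mem_cons] at m1 m2
    have l1 : toLex k' ≤ toLex k := by
      rcases m1 with m | m | m
      · exact (chain_rel hd _ m).le
      · rw [m]
      · exact (chain_rel hb _ m).le
    have l2 : toLex k ≤ toLex k' := by
      rcases m2 with m | m | m
      · exact (chain_rel hd' _ m).le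
      · rw [m]
      · exact (chain_rel hb' _ m).le
    exact toLex.injective (le_antisymm l2 l1)
  subst hk
  have n1 : k ∉ d.reverse := by
    intro hm; exact lt_irrefl _ (chain_rel hd k (by simpa using hm))
  have n2 : k ∉ b := fun hm => lt_irrefl _ (chain_rel hb k hm)
  have n3 : k ∉ d'.reverse := by
    intro hm; exact lt_irrefl _ (chain_rel hd' k (by simpa using hm))
  have n4 : k ∉ b' := fun hm => lt_irrefl _ (chain_rel hb' k hm)
  obtain ⟨e1, e2⟩ : d.reverse = d'.reverse ∧ b = b' := by
    rcases List.append_eq_append_iff.1 h with ⟨c, hc, e⟩ | ⟨c, hc, e⟩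
    · cases c with
      | nil => simp at hc e; exact ⟨by simp [hc], e⟩
      | cons x c =>
        simp at e
        exact absurd (by rw [hc, e.1]; simp) n3
    · cases c with
      | nil => simp at hc e; exact ⟨by simp [hc], e.symm⟩
      | cons x c =>
        simp at e
        exact absurd (by rw [hc, e.1]; simp) n1
  exact ⟨rfl, by simpa using e1, e2⟩

/-- Gluing two ascending paths at their common start. -/
def glue (la mu : Wt N) (t : Σ k : Wt N, (ascSet k la) × (ascSet k mu)) : irrSet la mu :=
  ⟨t.2.1.1.tail.reverse ++ t.1 :: t.2.2.1.tail, by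
    apply glue_mem
    · rw [← ascSet_cons t.2.1.2]; exact t.2.1.2
    · rw [← ascSet_cons t.2.2.2]; exact t.2.2.2⟩

theorem glue_bij (la mu : Wt N) : Function.Bijective (glue la mu) := by
  constructor
  · rintro ⟨k, ⟨p, hp⟩, ⟨q, hq⟩⟩ ⟨k', ⟨p', hp'⟩, ⟨q', hq'⟩⟩ h
    have h' := congrArg Subtype.val h
    simp only [glue] at h'
    have e1 := ascSet_cons hp
    have e2 := ascSet_cons hq
    have e3 := ascSet_cons hp'
    have e4 := ascSet_cons hq'
    obtain ⟨rfl, a, b⟩ := glue_inj (e1 ▸ hp.2.2.1) (e2 ▸ hq.2.2.1) (e3 ▸ hp'.2.2.1)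
      (e4 ▸ hq'.2.2.1) h'
    have r1 : p = p' := by rw [e1, e3, a]
    have r2 : q = q' := by rw [e2, e4, b]
    subst r1; subst r2; rfl
  · rintro ⟨w, h1, h2, h3, h4, h5⟩
    obtain ⟨k, d, b, rfl, hd, hb⟩ := decomp h1 h4 h5
    have m1 : (k :: d) ∈ ascSet k la := by
      refine ⟨by simp, by rw [← head_rev k d b, h2], hd, ?_⟩
      have : Irreducible (d.reverse ++ [k]) := irr_infix h5 ⟨[], b, by simp⟩
      simpa using irr_reverse this
    have m2 : (k :: b) ∈ ascSet k mu :=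
      ⟨by simp, by rw [← last_rev k d b, h3], hb, irr_infix h5 ⟨d.reverse, [], by simp⟩⟩
    exact ⟨⟨k, ⟨_, m1⟩, ⟨_, m2⟩⟩, rfl⟩

theorem irr_ncard (la mu : Wt N) :
    (irrSet la mu).ncard = ∑ k : Wt N, (ascSet k la).ncard * (ascSet k mu).ncard := by
  haveI : ∀ k l : Wt N, Finite (ascSet k l) := fun k l => (ascSet_finite k l).to_subtype
  rw [← Nat.card_coe_set_eq, ← Nat.card_congr (Equiv.ofBijective _ (glue_bij la mu)),
    Nat.card_sigma]
  simp only [Nat.card_prod, Nat.card_coe_set_eq]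

end Kh

namespace Kh

/-- The number of irreducible paths from `λ` to `μ` in `Q̄_m^n`
equals `Σ_κ P_{κ,λ}(1)·P_{κ,μ}(1)`, the sum running over all weights `κ` of type
`(m,n)`, where `P` is the Kazhdan–Lusztig polynomial (generating function of
ascending irreducible paths). -/
theorem statement12 (m n : ℕ) (hm : 1 ≤ m) (hn : 1 ≤ n) {N : ℕ} (hN : N = m + n)
    (la mu : Wt N) (hla : IsWeight m n la) (hmu : IsWeight m n mu)
    (P : Wt N → Wt N → Polynomial ℤ)
    (hP : ∀ (ka ka' : Wt N) (k : ℕ), (P ka ka').coeff k = (ascCount k ka ka' : ℤ)) :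
    (irrCount la mu : ℤ) =
      ∑ᶠ ka ∈ {ka : Wt N | IsWeight m n ka},
        (P ka la).eval 1 * (P ka mu).eval 1 := by
  have h1 : irrCount la mu = (irrSet la mu).ncard := rfl
  rw [h1, irr_ncard]
  have h2 : ∀ ka ∈ {ka : Wt N | IsWeight m n ka}, (P ka la).eval 1 * (P ka mu).eval 1 =
      ((ascSet ka la).ncard * (ascSet ka mu).ncard : ℤ) := by
    intro ka _
    rw [eval_eq (hP ka la), eval_eq (hP ka mu)]
  rw [finsum_mem_congr rfl h2, finsum_mem_eq_finite_toFinset_sum _ (Set.toFinite _)]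
  push_cast
  symm
  refine Finset.sum_subset (Finset.subset_univ _) ?_
  intro ka _ hka
  simp only [Set.Finite.mem_toFinset, Set.mem_setOf_eq] at hka
  have : ascSet ka la = ∅ := by
    rw [Set.eq_empty_iff_forall_notMem]
    rintro p ⟨p1, p2, p3, -⟩
    exact hka ((chain_weight p3 p1 p2).2 hla)
  simp [this]


end Kh
end
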